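/- arXiv:0905.3475 — 7 statements merged into one kernel-verified Lean document; each statement's English description precedes it below -/
import Mathlib

section
/- Every connected finite simple graph G that is not a Gallai tree contains an even cycle C with at most one chord as an induced subgraph; that is, there exists a set S of vertices of G of even cardinality at least 4 such that the subgraph of G induced on S is either a cycle on S or a cycle on S together with exactly one chord. -/
/-- The graph induced by `G` on `B` has no cut vertex: removing any vertex of `B`
leaves an induced subgraph that is still connected (trivially true for a single vertex). -/
def NoCutVertex {V : Type*} (G : SimpleGraph V) (B : Set V) : Prop :=
  ∀ v ∈ B, B = {v} ∨ (G.induce (B \ {v})).Connected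

/-- `B` is the vertex set of a block of `G`: a maximal set of vertices inducing a
connected subgraph with no cut vertex. -/
def IsBlock {V : Type*} (G : SimpleGraph V) (B : Set V) : Prop :=
  (G.induce B).Connected ∧ NoCutVertex G B ∧
    ∀ B' : Set V, B ⊆ B' → (G.induce B').Connected → NoCutVertex G B' → B' = B

/-- The subgraph of `G` induced on `B` is a cycle with an odd number of vertices. -/
def IsOddCycleSet {V : Type*} (G : SimpleGraph V) (B : Set V) : Prop :=
  ∃ n : ℕ, Odd n ∧ 3 ≤ n ∧ Nonempty (G.induce B ≃g SimpleGraph.cycleGraph n)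

/-- A Gallai tree: a graph each of whose blocks is a complete graph or an odd cycle. -/
def IsGallaiTree {V : Type*} (G : SimpleGraph V) : Prop :=
  ∀ B : Set V, IsBlock G B → G.IsClique B ∨ IsOddCycleSet G B

/-- The set of chords of a cycle `c`: edges of `G` joining two vertices of `c` that are
not consecutive on `c` (i.e. edges on the vertex set of `c` that are not edges of `c`). -/
def chordSet {V : Type*} (G : SimpleGraph V) {v : V} (c : G.Walk v v) : Set (Sym2 V) :=
  {e ∈ G.edgeSet | (∀ x ∈ e, x ∈ c.support) ∧ e ∉ c.edges}

namespace GT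

def P {W : Type*} (H : SimpleGraph W) (f : ℕ → W) (l : ℕ) : Prop :=
  (∀ i, i < l → H.Adj (f i) (f (i+1))) ∧ (∀ i j, i ≤ l → j ≤ l → f i = f j → i = j)

def NIP {W : Type*} (H : SimpleGraph W) (f : ℕ → W) (l : ℕ) : Prop :=
  P H f l ∧ ∀ i j, i < j → j ≤ l → H.Adj (f i) (f j) → j = i + 1 ∨ (i = 0 ∧ j = l)

def Good {W : Type*} (H : SimpleGraph W) : Prop :=
  ∃ (f : ℕ → W) (l : ℕ), P H f l ∧ H.Adj (f l) (f 0) ∧ Odd l ∧ 3 ≤ l ∧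
    ∃ e : Sym2 W, ∀ i j, i < j → j ≤ l → H.Adj (f i) (f j) →
      j = i + 1 ∨ (i = 0 ∧ j = l) ∨ s(f i, f j) = e

def TwoConn {W : Type*} (H : SimpleGraph W) : Prop :=
  ∀ v a b : W, a ≠ v → b ≠ v → ∃ (s : ℕ → W) (L : ℕ), s 0 = a ∧ s L = b ∧ P H s L ∧
    ∀ i, i ≤ L → s i ≠ v

lemma walk_of_fun {W : Type*} (H : SimpleGraph W) (f : ℕ → W) (l : ℕ)
    (h : ∀ i, i < l → H.Adj (f i) (f (i+1))) :
    ∃ p : H.Walk (f 0) (f l), p.support = (List.range (l+1)).map f ∧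
      p.edges = (List.range l).map (fun i => s(f i, f (i+1))) := by
  induction l with
  | zero => exact ⟨SimpleGraph.Walk.nil, by simp, by simp⟩
  | succ l ih =>
    obtain ⟨p, hp, he⟩ := ih (fun i hi => h i (by omega))
    refine ⟨p.concat (h l (by omega)), ?_, ?_⟩
    · rw [SimpleGraph.Walk.support_concat, hp, List.range_succ (n := l+1)]
      simp
    · rw [SimpleGraph.Walk.edges_concat, he, List.range_succ (n := l)]
      simp

lemma final {V : Type*} (G : SimpleGraph V) (h : Good G) :
    ∃ S : Set V, Even S.ncard ∧ 4 ≤ S.ncard ∧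
      ∃ (v : V) (c : G.Walk v v), c.IsCycle ∧ {x | x ∈ c.support} = S ∧
        (chordSet G c).Subsingleton := by
  obtain ⟨f, l, ⟨hadj, hinj⟩, hcl, hodd, h3, e, he⟩ := h
  obtain ⟨p, hp, hpe⟩ := walk_of_fun G f l hadj
  have hcyc : (SimpleGraph.Walk.cons hcl p).IsCycle := by
    rw [SimpleGraph.Walk.cons_isCycle_iff]
    constructor
    · rw [SimpleGraph.Walk.isPath_def, hp]
      refine List.Nodup.map_on ?_ List.nodup_range
      intro x hx y hy hxy
      simp only [List.mem_range] at hx hy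
      exact hinj x y (by omega) (by omega) hxy
    · rw [hpe]
      simp only [List.mem_map, List.mem_range, not_exists, not_and]
      intro i hi hs
      rw [Sym2.eq_iff] at hs
      rcases hs with ⟨h1, h2⟩ | ⟨h1, h2⟩
      · have := hinj _ _ (by omega) (by omega) h1; omega
      · have := hinj _ _ (by omega) (by omega) h1
        have := hinj _ _ (by omega) (by omega) h2; omega
  have hsup : ∀ x, x ∈ (SimpleGraph.Walk.cons hcl p).support ↔ ∃ i, i ≤ l ∧ f i = x := by
    intro x
    rw [SimpleGraph.Walk.support_cons, List.mem_cons, hp]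
    simp only [List.mem_map, List.mem_range]
    constructor
    · rintro (h | ⟨i, hi, h⟩)
      · exact ⟨l, le_rfl, h.symm⟩
      · exact ⟨i, by omega, h⟩
    · rintro ⟨i, hi, h⟩
      exact Or.inr ⟨i, by omega, h⟩
  have hcard : ({x | x ∈ (SimpleGraph.Walk.cons hcl p).support} : Set V).ncard = l + 1 := by
    have : ({x | x ∈ (SimpleGraph.Walk.cons hcl p).support} : Set V)
        = f '' (↑(Finset.range (l+1)) : Set ℕ) := by
      ext x
      simp only [Set.mem_setOf_eq, hsup, Set.mem_image, Finset.coe_range, Set.mem_Iio]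
      constructor
      · rintro ⟨i, hi, h⟩; exact ⟨i, by omega, h⟩
      · rintro ⟨i, hi, h⟩; exact ⟨i, by omega, h⟩
    rw [this, Set.ncard_image_of_injOn, Set.ncard_coe_finset, Finset.card_range]
    intro x hx y hy hxy
    simp only [Finset.coe_range, Set.mem_Iio] at hx hy
    exact hinj x y (by omega) (by omega) hxy
  refine ⟨_, ?_, ?_, f l, SimpleGraph.Walk.cons hcl p, hcyc, rfl, ?_⟩
  · rw [hcard]; exact hodd.add_one
  · rw [hcard]; omega
  · have key : ∀ d ∈ chordSet G (SimpleGraph.Walk.cons hcl p), d = e := by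
      intro d hd
      obtain ⟨hd1, hd2, hd3⟩ := hd
      induction d with
      | h x y =>
      have main : ∀ i j, i < j → j ≤ l → s(x, y) = s(f i, f j) → s(x,y) = e := by
        intro i j hij hj hs
        rw [hs] at hd1 hd3 ⊢
        rw [SimpleGraph.Walk.edges_cons, hpe] at hd3
        simp only [List.mem_cons, List.mem_map, List.mem_range, not_or] at hd3
        rcases he i j hij hj hd1 with h | ⟨h, h'⟩ | h
        · subst h
          exact absurd ⟨i, by omega, rfl⟩ hd3.2
        · subst h h'
          exact absurd Sym2.eq_swap hd3.1
        · exact h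
      obtain ⟨i, hi, rfl⟩ := (hsup x).1 (hd2 x (by simp))
      obtain ⟨j, hj, rfl⟩ := (hsup y).1 (hd2 y (by simp))
      rcases lt_trichotomy i j with h | h | h
      · exact main i j h hj rfl
      · subst h; exact absurd hd1 (by simp)
      · exact main j i h hi Sym2.eq_swap
    intro a ha b hb
    rw [key a ha, key b hb]

lemma NIP.rev {W : Type*} {H : SimpleGraph W} {f : ℕ → W} {l : ℕ} (h : NIP H f l) :
    NIP H (fun k => f (l - k)) l := by
  obtain ⟨⟨h1, h2⟩, h3⟩ := h
  refine ⟨⟨?_, ?_⟩, ?_⟩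
  · intro i hi
    have := h1 (l - (i+1)) (by omega)
    rw [show l - (i+1) + 1 = l - i by omega] at this
    exact this.symm
  · intro i j hi hj hh
    have := h2 _ _ (by omega) (by omega) hh
    omega
  · intro i j hij hj ha
    have := h3 (l - j) (l - i) (by omega) (by omega) ha.symm
    omega

def Ear {W : Type*} (H : SimpleGraph W) (K : Set W) (w : ℕ → W) (m : ℕ) : Prop :=
  2 ≤ m ∧ w 0 ∈ K ∧ w m ∈ K ∧ w 0 ≠ w m ∧ (∀ i, 0 < i → i < m → w i ∉ K) ∧
    ∀ i, i < m → H.Adj (w i) (w (i+1))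

/-- cut out the part between `i` and `j` -/
lemma Ear.cut {W : Type*} {H : SimpleGraph W} {K : Set W} {w : ℕ → W} {m : ℕ}
    (h : Ear H K w m) (i d : ℕ) (hd : i + d + 1 ≤ m) (hm : 2 + d ≤ m)
    (ha : H.Adj (w i) (w (i + 1 + d))) :
    Ear H K (fun k => if k ≤ i then w k else w (k + d)) (m - d) := by
  obtain ⟨h1, h2, h3, h4, h5, h6⟩ := h
  have e : (fun k => if k ≤ i then w k else w (k + d)) (m - d) = w m := by
    simp only
    rw [if_neg (by omega)]; congr 1; omega
  refine ⟨by omega, by simpa using h2, by rw [e]; exact h3, by rw [e]; simpa using h4, ?_, ?_⟩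
  · intro k hk hk'
    simp only
    split_ifs
    · exact h5 k hk (by omega)
    · exact h5 _ (by omega) (by omega)
  · intro k hk
    simp only
    rcases lt_trichotomy k i with hh | hh | hh
    · rw [if_pos (by omega), if_pos (by omega)]; exact h6 k (by omega)
    · subst hh
      rw [if_pos le_rfl, if_neg (by omega)]; exact ha
    · rw [if_neg (by omega), if_neg (by omega)]
      have := h6 (k + d) (by omega)
      rwa [show k + d + 1 = k + 1 + d by omega] at this

lemma ear_good {W : Type*} (H : SimpleGraph W) (K : Set W)
    (hN : ∀ p, p ∉ K → ∀ u ∈ K, ∀ v ∈ K, H.Adj p u → H.Adj p v → u = v)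
    (hE : ∃ w m, Ear H K w m)
    (hQ : ∀ u ∈ K, ∀ v ∈ K, u ≠ v → ∀ r, r < 2 → ∃ q l, NIP H q l ∧ 1 ≤ l ∧ q 0 = u ∧ q l = v ∧
      (∀ i, i ≤ l → q i ∈ K) ∧ l % 2 = r) : Good H := by
  classical
  have hE' : ∃ m w, Ear H K w m := by obtain ⟨w, m, h⟩ := hE; exact ⟨m, w, h⟩
  obtain ⟨w, hw⟩ := Nat.find_spec hE'
  set m := Nat.find hE' with hmdef
  have hmin : ∀ m' w', Ear H K w' m' → m ≤ m' := fun m' w' h => Nat.find_min' hE' ⟨w', h⟩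
  clear_value m
  have hw0 := hw
  obtain ⟨h1, h2, h3, h4, h5, h6⟩ := hw
  have hchord : ∀ i j, i < j → j ≤ m → H.Adj (w i) (w j) → j = i + 1 ∨ (i = 0 ∧ j = m) := by
    intro i j hij hj ha
    by_contra hcon
    have := hmin _ _ (hw0.cut i (j - i - 1) (by omega) (by omega)
      (by rwa [show i + 1 + (j - i - 1) = j by omega]))
    omega
  have hinj' : ∀ i j, i < j → j ≤ m → w i ≠ w j := by
    intro i j hij hj he
    by_cases hi : i = 0
    · subst hi
      by_cases hjm : j = m
      · subst hjm; exact h4 he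
      · exact h5 j hij (by omega) (he ▸ h2)
    by_cases hjm : j = m
    · subst hjm; exact h5 i (by omega) (by omega) (he ▸ h3)
    have ha := h6 j (by omega)
    rw [← he] at ha
    have := hchord i (j+1) (by omega) (by omega) ha
    omega
  have hinj : ∀ i j, i ≤ m → j ≤ m → w i = w j → i = j := by
    intro i j hi hj he
    rcases lt_trichotomy i j with h | h | h
    · exact absurd he (hinj' i j h hj)
    · exact h
    · exact absurd he.symm (hinj' j i h hi)
  have hout : ∀ i, 0 < i → i < m → ∀ y ∈ K, H.Adj (w i) y → y = w 0 ∨ y = w m := by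
    intro i hi him y hy ha
    by_contra hcon
    push Not at hcon
    by_cases him' : i + 1 = m
    · exact hcon.2 (hN (w i) (h5 i hi him) y hy (w m) h3 ha (him' ▸ h6 i him))
    have : Ear H K (fun k => if k ≤ i then w k else y) (i+1) := by
      refine ⟨by omega, by simpa using h2, by simpa using hy, by simpa using hcon.1.symm, ?_, ?_⟩
      · intro k hk hk'
        simp only
        rw [if_pos (by omega)]
        exact h5 k hk (by omega)
      · intro k hk
        simp only
        by_cases hki : k = i
        · subst hki; simpa using ha
        · rw [if_pos (by omega), if_pos (by omega)]
          exact h6 k (by omega)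
    have := hmin _ _ this
    omega
  obtain ⟨q, l, ⟨⟨q1, q2⟩, q3⟩, hl, q0, ql, qK, hpar⟩ :=
    hQ (w 0) h2 (w m) h3 h4 (m % 2) (Nat.mod_lt _ (by omega))
  have hA : ∀ i, i ≤ m → ∀ b, 0 < b → b < l → H.Adj (w i) (q b) →
      (i = 0 ∧ b = 1) ∨ (i = m ∧ b + 1 = l) := by
    intro i hi b hb hbl ha
    by_cases hi0 : i = 0
    · subst hi0
      rw [← q0] at ha
      have := q3 0 b hb (by omega) ha
      omega
    by_cases him : i = m
    · subst him
      rw [← ql] at ha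
      have := q3 b l hbl (by omega) ha.symm
      omega
    exfalso
    rcases hout i (by omega) (by omega) (q b) (qK b (by omega)) ha with h | h
    · rw [← q0] at h
      have := q2 _ _ (by omega) (by omega) h; omega
    · rw [← ql] at h
      have := q2 _ _ (by omega) (by omega) h; omega
  have hB : ∀ i, i ≤ m → ∀ b, 0 < b → b < l → w i ≠ q b := by
    intro i hi b hb hbl h
    by_cases hi0 : i = 0
    · subst hi0
      rw [← q0] at h
      have := q2 _ _ (by omega) (by omega) h; omega
    by_cases him : i = m
    · subst him
      rw [← ql] at h
      have := q2 _ _ (by omega) (by omega) h; omega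
    exact h5 i (by omega) (by omega) (h ▸ qK b (by omega))
  refine ⟨fun k => if k ≤ m then w k else q (l + m - k), m + l - 1, ⟨?_, ?_⟩, ?_, ?_, ?_,
    s(w 0, w m), ?_⟩
  · intro k hk
    simp only
    rcases lt_trichotomy k m with h | h | h
    · rw [if_pos (by omega), if_pos (by omega)]; exact h6 k h
    · subst h
      rw [if_pos le_rfl, if_neg (by omega), ← ql]
      have := q1 (l - 1) (by omega)
      rw [show l - 1 + 1 = l by omega] at this
      rw [show l + k - (k + 1) = l - 1 by omega]
      exact this.symm
    · rw [if_neg (by omega), if_neg (by omega)]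
      have := q1 (l + m - (k+1)) (by omega)
      rw [show l + m - (k+1) + 1 = l + m - k by omega] at this
      exact this.symm
  · intro i j hi hj he
    simp only at he
    split_ifs at he with hi' hj' hj'
    · exact hinj i j hi' hj' he
    · exact absurd he (hB i hi' _ (by omega) (by omega))
    · exact absurd he.symm (hB j hj' _ (by omega) (by omega))
    · have := q2 _ _ (by omega) (by omega) he; omega
  · simp only
    rw [if_pos (Nat.zero_le m), ← q0]
    have := q1 0 (by omega)
    split_ifs with h
    · have hl1 : l = 1 := by omega
      subst hl1
      rw [show m + 1 - 1 = m by omega, ← ql]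
      exact this.symm
    · rw [show l + m - (m + l - 1) = 1 by omega]
      exact this.symm
  · rw [Nat.odd_iff]; omega
  · omega
  · intro i j hij hj ha
    simp only at ha ⊢
    by_cases hi' : i ≤ m <;> by_cases hj' : j ≤ m
    · rw [if_pos hi', if_pos hj'] at ha ⊢
      rcases hchord i j hij hj' ha with h | ⟨h, h'⟩
      · exact Or.inl h
      · subst h h'; exact Or.inr (Or.inr rfl)
    · rw [if_pos hi', if_neg hj'] at ha
      have := hA i hi' _ (by omega) (by omega) ha
      omega
    · omega
    · rw [if_neg hi', if_neg hj'] at ha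
      have := q3 _ _ (by omega) (by omega) ha.symm
      omega

lemma exists_ear {W : Type*} (H : SimpleGraph W) (hc : H.Connected) (h2 : TwoConn H) (K : Set W)
    (hK : ∃ x ∈ K, ∃ y ∈ K, x ≠ y) (hU : ∃ z, z ∉ K) : ∃ w m, Ear H K w m := by
  classical
  obtain ⟨x, hx, y, hy, hxy⟩ := hK
  obtain ⟨z, hz⟩ := hU
  obtain ⟨p⟩ := hc.preconnected x z
  obtain ⟨d, -, hd1, hd2⟩ := p.exists_boundary_dart K hx hz
  obtain ⟨⟨u, a⟩, had⟩ := d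
  simp only at hd1 hd2 had
  obtain ⟨t, ht, htu⟩ : ∃ t ∈ K, t ≠ u := by
    by_cases h : x = u
    · exact ⟨y, hy, fun h' => hxy (h.trans h'.symm)⟩
    · exact ⟨x, hx, h⟩
  obtain ⟨s, L, s0, sL, ⟨s1, s2⟩, s3⟩ := h2 u a t had.ne.symm htu
  have hex : ∃ m, m ≤ L ∧ s m ∈ K := ⟨L, le_rfl, sL ▸ ht⟩
  obtain ⟨hm1, hm2⟩ := Nat.find_spec hex
  have hmin : ∀ k, k < Nat.find hex → s k ∉ K := fun k hk h =>
    Nat.find_min hex hk ⟨by omega, h⟩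
  set m := Nat.find hex
  clear_value m
  have hm0 : m ≠ 0 := by rintro rfl; exact hd2 (s0 ▸ hm2)
  refine ⟨fun k => if k = 0 then u else s (k - 1), m + 1, by omega, by simpa using hd1,
    by simpa using hm2, by simpa using (s3 m hm1).symm, ?_, ?_⟩
  · intro i hi hi'
    simp only
    rw [if_neg (by omega)]
    exact hmin _ (by omega)
  · intro i hi
    simp only
    by_cases h : i = 0
    · subst h; simpa [s0] using had
    · rw [if_neg h, if_neg (by omega)]
      have := s1 (i - 1) (by omega)
      rwa [show i - 1 + 1 = i + 1 - 1 by omega] at this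

lemma exists_cycle {W : Type*} (H : SimpleGraph W) (hc : H.Connected) (h2 : TwoConn H)
    (x y : W) (hxy : x ≠ y) (hna : ¬ H.Adj x y) :
    ∃ l f, P H f l ∧ 2 ≤ l ∧ H.Adj (f l) (f 0) := by
  obtain ⟨p⟩ := hc.preconnected x y
  obtain ⟨d, -, hd1, hd2⟩ := p.exists_boundary_dart {z | z = x ∨ H.Adj x z} (Or.inl rfl)
    (by rintro (h | h); exacts [hxy h.symm, hna h])
  obtain ⟨⟨v, b⟩, had⟩ := d
  simp only [Set.mem_setOf_eq, not_or] at hd1 hd2 had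
  have hxv : H.Adj x v := by
    rcases hd1 with h | h
    · subst h; exact absurd had hd2.2
    · exact h
  obtain ⟨s, L, s0, sL, ⟨s1, s2⟩, s3⟩ := h2 v x b hxv.ne had.ne.symm
  have hL : L ≠ 0 := by rintro rfl; exact hd2.1 (sL.symm.trans s0)
  refine ⟨L + 1, fun k => if k = 0 then v else s (k - 1), ⟨?_, ?_⟩, by omega, ?_⟩
  · intro i hi
    simp only
    by_cases h : i = 0
    · subst h; simpa [s0] using hxv.symm
    · rw [if_neg h, if_neg (by omega)]
      have := s1 (i - 1) (by omega)
      rwa [show i - 1 + 1 = i + 1 - 1 by omega] at this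
  · intro i j hi hj he
    simp only at he
    split_ifs at he with h h' h'
    · omega
    · exact absurd he.symm (s3 _ (by omega))
    · exact absurd he (s3 _ (by omega))
    · have := s2 _ _ (by omega) (by omega) he; omega
  · simpa [sL] using had.symm

lemma clique_case {W : Type*} [Finite W] (H : SimpleGraph W) (hc : H.Connected) (h2 : TwoConn H)
    (hne : ∃ x y, x ≠ y ∧ ¬ H.Adj x y) (a b c : W) (hab : H.Adj a b) (hbc : H.Adj b c)
    (hca : H.Adj c a) : Good H := by
  classical
  have h0 : H.IsClique ({a, b, c} : Set W) := by
    intro u hu v hv huv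
    simp only [Set.mem_insert_iff, Set.mem_singleton_iff] at hu hv
    rcases hu with rfl | rfl | rfl <;> rcases hv with rfl | rfl | rfl <;>
      first | exact absurd rfl huv | assumption | (apply SimpleGraph.Adj.symm; assumption)
  obtain ⟨K, hK0, hKm⟩ := Finite.exists_le_maximal (p := fun K : Set W => H.IsClique K) h0
  have ha : a ∈ K := hK0 (by simp)
  have hb : b ∈ K := hK0 (by simp)
  have hcK : c ∈ K := hK0 (by simp)
  have hcl : H.IsClique K := hKm.prop
  by_cases hN : ∀ p, p ∉ K → ∀ u ∈ K, ∀ v ∈ K, H.Adj p u → H.Adj p v → u = v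
  · refine ear_good H K hN (exists_ear H hc h2 K ⟨a, ha, b, hb, hab.ne⟩ ?_) ?_
    · by_contra hcon
      push Not at hcon
      obtain ⟨x, y, hxy, hn⟩ := hne
      exact hn (hcl (hcon x) (hcon y) hxy)
    · intro u hu v hv huv r hr
      have huv' := hcl hu hv huv
      obtain rfl | rfl : r = 1 ∨ r = 0 := by omega
      · refine ⟨fun k => if k = 0 then u else v, 1, ⟨⟨?_, ?_⟩, ?_⟩, le_rfl, by simp, by simp, ?_, rfl⟩
        · intro i hi
          obtain rfl : i = 0 := by omega
          simpa using huv'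
        · intro i j hi hj he
          simp only at he
          split_ifs at he with h h' h'
          · omega
          · exact absurd he huv
          · exact absurd he.symm huv
          · omega
        · intro i j hij hj _; omega
        · intro i _
          simp only
          split_ifs <;> assumption
      · obtain ⟨z, hz, hzu, hzv⟩ : ∃ z ∈ K, z ≠ u ∧ z ≠ v := by
          by_contra hcon
          push Not at hcon
          have e1 := hcon a ha
          have e2 := hcon b hb
          have e3 := hcon c hcK
          have := hab.ne
          have := hbc.ne
          have := hca.ne
          grind
        refine ⟨fun k => if k = 0 then u else if k = 1 then z else v, 2, ⟨⟨?_, ?_⟩, ?_⟩,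
          by omega, by simp, by simp, ?_, rfl⟩
        · intro i hi
          obtain rfl | rfl : i = 0 ∨ i = 1 := by omega
          · simpa using hcl hu hz hzu.symm
          · simpa using hcl hz hv hzv
        · intro i j hi hj he
          simp only at he
          grind
        · intro i j hij hj _; omega
        · intro i _
          simp only
          split_ifs <;> assumption
  · push Not at hN
    obtain ⟨p, hp, u, hu, v, hv, hpu, hpv, huv⟩ := hN
    obtain ⟨z, hz, hpz⟩ : ∃ z ∈ K, ¬ H.Adj p z := by
      by_contra hcon
      push Not at hcon
      have : H.IsClique (insert p K) := by
        rw [SimpleGraph.isClique_insert]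
        exact ⟨hcl, fun b hb _ => hcon b hb⟩
      exact hp (hKm.le_of_ge this (Set.subset_insert p K) (Set.mem_insert p K))
    have hzu : z ≠ u := by rintro rfl; exact hpz hpu
    have hzv : z ≠ v := by rintro rfl; exact hpz hpv
    have hpz' : p ≠ z := by rintro rfl; exact hp hz
    have hpu' := hpu.ne
    have hpv' := hpv.ne
    refine ⟨fun k => if k = 0 then p else if k = 1 then u else if k = 2 then z else v, 3,
      ⟨?_, ?_⟩, by simpa using hpv.symm, by decide, le_rfl, s(u, v), ?_⟩
    · intro i hi
      obtain rfl | rfl | rfl : i = 0 ∨ i = 1 ∨ i = 2 := by omega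
      · simpa using hpu
      · simpa using hcl hu hz hzu.symm
      · simpa using hcl hz hv hzv
    · intro i j hi hj he
      simp only at he
      grind
    · intro i j hij hj hadj
      by_cases h1 : j = i + 1
      · exact Or.inl h1
      by_cases h2 : i = 0 ∧ j = 3
      · exact Or.inr (Or.inl h2)
      obtain ⟨rfl, rfl⟩ | ⟨rfl, rfl⟩ : (i = 0 ∧ j = 2) ∨ (i = 1 ∧ j = 3) := by omega
      · exact absurd (by simpa using hadj) hpz
      · right; right; simp

lemma hole_case {W : Type*} (H : SimpleGraph W) (hc : H.Connected) (h2 : TwoConn H)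
    (hno : ¬ ∃ n : ℕ, Odd n ∧ 3 ≤ n ∧ Nonempty (H ≃g SimpleGraph.cycleGraph n))
    (f : ℕ → W) (l : ℕ) (hP : P H f l) (hl : 4 ≤ l) (hev : l % 2 = 0) (hcl : H.Adj (f l) (f 0))
    (hmin : ∀ l' f', P H f' l' → 2 ≤ l' → H.Adj (f' l') (f' 0) → l ≤ l')
    (hch : ∀ i j, i < j → j ≤ l → H.Adj (f i) (f j) → j = i + 1 ∨ (i = 0 ∧ j = l)) : Good H := by
  classical
  obtain ⟨h1, hi⟩ := hP
  -- arcs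
  have arc1 : ∀ i j, i < j → j ≤ l → NIP H (fun k => f (i + k)) (j - i) := by
    intro i j hij hj
    refine ⟨⟨?_, ?_⟩, ?_⟩
    · intro k hk; exact h1 (i + k) (by omega)
    · intro a b ha hb he
      have := hi _ _ (by omega) (by omega) he; omega
    · intro a b hab hb ha
      have := hch _ _ (by omega) (by omega) ha; omega
  have arc2 : ∀ i j, i < j → j ≤ l →
      NIP H (fun k => if k ≤ i then f (i - k) else f (l + 1 + i - k)) (l + 1 + i - j) := by
    intro i j hij hj
    refine ⟨⟨?_, ?_⟩, ?_⟩
    · intro k hk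
      simp only
      rcases lt_trichotomy k i with h | h | h
      · rw [if_pos (by omega), if_pos (by omega)]
        have := h1 (i - (k+1)) (by omega)
        rw [show i - (k+1) + 1 = i - k by omega] at this
        exact this.symm
      · subst h
        rw [if_pos le_rfl, if_neg (by omega)]
        rw [show k - k = 0 by omega, show l + 1 + k - (k+1) = l by omega]
        exact hcl.symm
      · rw [if_neg (by omega), if_neg (by omega)]
        have := h1 (l + 1 + i - (k+1)) (by omega)
        rw [show l + 1 + i - (k+1) + 1 = l + 1 + i - k by omega] at this
        exact this.symm
    · intro a b ha hb he
      simp only at he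
      split_ifs at he with h h' h'
      all_goals
        have := hi _ _ (by omega) (by omega) he
        omega
    · intro a b hab hb ha
      simp only at ha
      split_ifs at ha with h h' h'
      · have := hch _ _ (by omega) (by omega) ha.symm; omega
      · have := hch _ _ (by omega) (by omega) ha; omega
      · omega
      · have := hch _ _ (by omega) (by omega) ha.symm; omega
  let K : Set W := {x | ∃ i, i ≤ l ∧ f i = x}
  have close : ∀ q m p, P H q m → 1 ≤ m → p ∉ K → (∀ k, k ≤ m → q k ∈ K) → H.Adj p (q 0) →
      H.Adj p (q m) → l ≤ m + 1 := by
    intro q m p hq hm hp hk ha hb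
    refine hmin (m+1) (fun k => if k ≤ m then q k else p) ⟨?_, ?_⟩ (by omega) ?_
    · intro k hk'
      simp only
      by_cases h : k = m
      · subst h; simpa using hb.symm
      · rw [if_pos (by omega), if_pos (by omega)]; exact hq.1 k (by omega)
    · intro a b ha' hb' he
      simp only at he
      split_ifs at he with h h' h'
      · exact hq.2 _ _ h h' he
      · exact absurd (he ▸ hk a h) hp
      · exact absurd (he ▸ hk b h') hp
      · omega
    · simpa using ha
  have hN' : ∀ p, p ∉ K → ∀ i j, i < j → j ≤ l → H.Adj p (f i) → H.Adj p (f j) → False := by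
    intro p hp i j hij hj ha hb
    have c1 := close _ _ p (arc1 i j hij hj).1 (by omega) hp
      (fun k hk => ⟨i + k, by omega, rfl⟩) (by simpa using ha)
      (by rwa [show i + (j - i) = j by omega])
    have c2 := close _ _ p (arc2 i j hij hj).1 (by omega) hp
      (fun k hk => by
        try simp only
        split_ifs
        · exact ⟨_, by omega, rfl⟩
        · exact ⟨_, by omega, rfl⟩) (by simpa using ha)
      (by
        rw [if_neg (by omega), show l + 1 + i - (l + 1 + i - j) = j by omega]; exact hb)
    omega
  have hQ' : ∀ i j, i < j → j ≤ l → ∀ r, r < 2 → ∃ q m, NIP H q m ∧ 1 ≤ m ∧ q 0 = f i ∧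
      q m = f j ∧ (∀ k, k ≤ m → q k ∈ K) ∧ m % 2 = r := by
    intro i j hij hj r hr
    by_cases hpar : (j - i) % 2 = r
    · exact ⟨_, _, arc1 i j hij hj, by omega, rfl, by
        rw [show i + (j - i) = j by omega],
        fun k hk => ⟨i + k, by omega, rfl⟩, hpar⟩
    · refine ⟨_, _, arc2 i j hij hj, by omega, by simp, ?_, ?_, by omega⟩
      · try simp only
        rw [if_neg (by omega), show l + 1 + i - (l + 1 + i - j) = j by omega]
      · intro k hk
        try simp only
        split_ifs
        · exact ⟨_, by omega, rfl⟩
        · exact ⟨_, by omega, rfl⟩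
  refine ear_good H K ?_ (exists_ear H hc h2 K ?_ ?_) ?_
  · rintro p hp _ ⟨i, hil, rfl⟩ _ ⟨j, hjl, rfl⟩ ha hb
    rcases lt_trichotomy i j with h | h | h
    · exact (hN' p hp i j h hjl ha hb).elim
    · rw [h]
    · exact (hN' p hp j i h hil hb ha).elim
  · exact ⟨f 0, ⟨0, by omega, rfl⟩, f l, ⟨l, le_rfl, rfl⟩, hcl.ne.symm⟩
  · by_contra hcon
    push Not at hcon
    apply hno
    refine ⟨l + 1, ?_, by omega, ?_⟩
    · rw [Nat.odd_iff]; omega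
    have hbij : Function.Bijective (fun i : Fin (l+1) => f i) := by
      constructor
      · intro a b he
        exact Fin.ext (hi _ _ (by omega) (by omega) he)
      · intro x
        obtain ⟨i, hil, rfl⟩ := hcon x
        exact ⟨⟨i, by omega⟩, rfl⟩
    refine ⟨(RelIso.symm (⟨Equiv.ofBijective _ hbij, ?_⟩ : SimpleGraph.cycleGraph (l+1) ≃g H))⟩
    have key : ∀ a b : Fin (l+1), a < b → (H.Adj (f a) (f b) ↔
        (b.val = a.val + 1 ∨ (a.val = 0 ∧ b.val = l))) := by
      intro a b hab
      have hab' : a.val < b.val := hab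
      constructor
      · intro h; exact hch a b hab (by omega) h
      · rintro (h | ⟨h, h'⟩)
        · rw [h]; exact h1 a (by omega)
        · rw [h, h']; exact hcl.symm
    have key2 : ∀ a b : Fin (l+1), a < b → ((SimpleGraph.cycleGraph (l+1)).Adj a b ↔
        (b.val = a.val + 1 ∨ (a.val = 0 ∧ b.val = l))) := by
      intro a b hab
      have hab' : a.val < b.val := hab
      rw [SimpleGraph.cycleGraph_adj', Fin.coe_sub_iff_lt.2 hab, Fin.coe_sub_iff_le.2 hab.le]
      omega
    intro a b
    simp only [Equiv.ofBijective_apply]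
    rcases lt_trichotomy a b with h | h | h
    · rw [key a b h, key2 a b h]
    · subst h; simp
    · rw [H.adj_comm, SimpleGraph.adj_comm _ a b, key b a h, key2 b a h]
  · rintro _ ⟨i, hil, rfl⟩ _ ⟨j, hjl, rfl⟩ hne r hr
    rcases lt_trichotomy i j with h | h | h
    · exact hQ' i j h hjl r hr
    · subst h; exact absurd rfl hne
    · obtain ⟨q, m, hq, hm, e0, em, hk, hp⟩ := hQ' j i h hil r hr
      exact ⟨_, m, hq.rev, hm, by simpa using em, by simpa using e0,
        fun k hk' => hk _ (by omega), hp⟩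

lemma core {W : Type*} [Finite W] (H : SimpleGraph W) (hc : H.Connected) (h2 : TwoConn H)
    (hne : ∃ x y, x ≠ y ∧ ¬ H.Adj x y)
    (hno : ¬ ∃ n : ℕ, Odd n ∧ 3 ≤ n ∧ Nonempty (H ≃g SimpleGraph.cycleGraph n)) : Good H := by
  classical
  have hex : ∃ l f, P H f l ∧ 2 ≤ l ∧ H.Adj (f l) (f 0) := by
    obtain ⟨x, y, hxy, hna⟩ := hne
    exact exists_cycle H hc h2 x y hxy hna
  obtain ⟨f, hP, hl2, hcl⟩ := Nat.find_spec hex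
  have hmin : ∀ l' f', P H f' l' → 2 ≤ l' → H.Adj (f' l') (f' 0) → Nat.find hex ≤ l' :=
    fun l' f' a b c => Nat.find_min' hex ⟨f', a, b, c⟩
  set l := Nat.find hex
  clear_value l
  have hch : ∀ i j, i < j → j ≤ l → H.Adj (f i) (f j) → j = i + 1 ∨ (i = 0 ∧ j = l) := by
    intro i j hij hj ha
    by_contra hcon
    have := hmin (j - i) (fun k => f (i + k)) ⟨fun k hk => hP.1 (i + k) (by omega),
      fun a b ha hb he => by have := hP.2 _ _ (by omega) (by omega) he; omega⟩ (by omega)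
      (by rw [show i + (j - i) = j by omega]; exact ha.symm)
    omega
  by_cases hpar : l % 2 = 0
  · by_cases h : l = 2
    · subst h
      exact clique_case H hc h2 hne (f 0) (f 1) (f 2) (hP.1 0 (by omega)) (hP.1 1 (by omega)) hcl
    · exact hole_case H hc h2 hno f l hP (by omega) hpar hcl hmin hch
  · refine ⟨f, l, hP, hcl, by rw [Nat.odd_iff]; omega, by omega, s(f 0, f 0), ?_⟩
    intro i j hij hj ha
    rcases hch i j hij hj ha with h | h
    · exact Or.inl h
    · exact Or.inr (Or.inl h)

end GT

/-- Every connected finite simple graph that is not a Gallai tree contains an even cycle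
with at most one chord as an induced subgraph: there is a set `S` of vertices of even
cardinality at least `4` such that the subgraph induced on `S` is a cycle on `S`,
possibly together with exactly one chord. -/
theorem structural_lemma {V : Type*} [Fintype V] (G : SimpleGraph V)
    (hconn : G.Connected) (hG : ¬ IsGallaiTree G) :
    ∃ S : Set V, Even S.ncard ∧ 4 ≤ S.ncard ∧
      ∃ (v : V) (c : G.Walk v v), c.IsCycle ∧ {x | x ∈ c.support} = S ∧
        (chordSet G c).Subsingleton := by
  classical
  apply GT.final
  unfold IsGallaiTree at hG
  push Not at hG
  obtain ⟨B, ⟨hB1, hB2, -⟩, hncl, hnodd⟩ := hG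
  have hT : GT.TwoConn (G.induce B) := by
    intro v a b hav hbv
    rcases hB2 v v.2 with h | h
    · exfalso
      apply hav
      have ha : a.1 ∈ ({v.1} : Set V) := h.subset a.2
      exact Subtype.ext ha
    · have ha' : a.1 ∈ B \ {v.1} := ⟨a.2, fun h => hav (Subtype.ext h)⟩
      have hb' : b.1 ∈ B \ {v.1} := ⟨b.2, fun h => hbv (Subtype.ext h)⟩
      obtain ⟨p, hp⟩ := (h.preconnected ⟨a, ha'⟩ ⟨b, hb'⟩).exists_isPath
      refine ⟨fun k => ⟨(p.getVert k).1, (p.getVert k).2.1⟩, p.length, ?_, ?_, ⟨?_, ?_⟩, ?_⟩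
      · simp
      · simp
      · intro i hi
        exact p.adj_getVert_succ hi
      · intro i j hi hj he
        refine hp.getVert_injOn hi hj (Subtype.ext ?_)
        simpa using he
      · intro i _ he
        exact (p.getVert i).2.2 (congrArg Subtype.val he)
  have hne : ∃ x y : B, x ≠ y ∧ ¬ (G.induce B).Adj x y := by
    by_contra hcon
    push Not at hcon
    apply hncl
    intro x hx y hy hxy
    exact hcon ⟨x, hx⟩ ⟨y, hy⟩ (fun h => hxy (congrArg Subtype.val h))
  obtain ⟨f, l, ⟨h1, h2⟩, hcl, hodd, h3, e, he⟩ := GT.core (G.induce B) hB1 hT hne hnodd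
  refine ⟨fun k => (f k).1, l, ⟨fun i hi => h1 i hi, fun i j hi hj h => h2 i j hi hj
    (Subtype.ext h)⟩, hcl, hodd, h3, e.map Subtype.val, ?_⟩
  intro i j hij hj ha
  rcases he i j hij hj ha with h | h | h
  · exact Or.inl h
  · exact Or.inr (Or.inl h)
  · right; right
    rw [← h]; rfl
end

section
/- Every connected finite simple graph G that is not a Gallai tree contains a cycle C such that the subgraph of G induced on the vertex set of C is neither a complete graph nor an odd cycle. -/
/-- The closed walk `c` is a cycle whose vertex set induces neither a complete graph
nor an odd cycle in `G`. -/
def IsNonCliqueNonOddCycle {V : Type*} (G : SimpleGraph V) {v : V} (c : G.Walk v v) : Prop :=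
  c.IsCycle ∧ ¬ G.IsClique {x | x ∈ c.support} ∧ ¬ IsOddCycleSet G {x | x ∈ c.support}

open SimpleGraph

theorem aux_path {V : Type*} (G : SimpleGraph V) {S : Set V} (h : (G.induce S).Connected)
    {x y : V} (hx : x ∈ S) (hy : y ∈ S) :
    ∃ p : G.Walk x y, p.IsPath ∧ ∀ w ∈ p.support, w ∈ S := by
  obtain ⟨p, hp⟩ := h.exists_isPath ⟨x, hx⟩ ⟨y, hy⟩
  let f : G.induce S →g G := (Embedding.induce S).toHom
  have hf : Function.Injective f := Subtype.val_injective
  have h1 : (p.map f).IsPath := (Walk.isPath_map_iff_of_injective hf).2 hp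
  have h2 : ∀ w ∈ (p.map f).support, w ∈ S := by
    intro w hw
    rw [Walk.support_map, List.mem_map] at hw
    obtain ⟨z, -, rfl⟩ := hw
    exact z.2
  exact ⟨p.map f, h1, h2⟩

theorem aux_p3 {V : Type*} (G : SimpleGraph V) {B : Set V} {x y : V} (p : G.Walk x y)
    (hB : ∀ w ∈ p.support, w ∈ B) (hne : x ≠ y) (hna : ¬ G.Adj x y) :
    ∃ u z w, u ∈ B ∧ z ∈ B ∧ w ∈ B ∧ G.Adj u z ∧ G.Adj z w ∧ u ≠ w ∧ ¬ G.Adj u w := by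
  induction p with
  | nil => exact absurd rfl hne
  | @cons x z y h p ih =>
    simp only [Walk.support_cons, List.mem_cons, forall_eq_or_imp] at hB
    by_cases hzy : z = y
    · subst hzy; exact absurd h hna
    by_cases ha : G.Adj z y
    · exact ⟨x, z, y, hB.1, hB.2 _ p.start_mem_support, hB.2 _ p.end_mem_support, h, ha, hne, hna⟩
    · exact ih hB.2 hzy ha

theorem aux_boundary {V : Type*} (G : SimpleGraph V) {B C : Set V} {x y : V} (p : G.Walk x y)
    (hB : ∀ w ∈ p.support, w ∈ B) (hx : x ∈ C) (hy : y ∉ C) :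
    ∃ a v, a ∈ C ∧ v ∈ B ∧ v ∉ C ∧ G.Adj a v := by
  induction p with
  | nil => exact absurd hx hy
  | @cons x z y h p ih =>
    simp only [Walk.support_cons, List.mem_cons, forall_eq_or_imp] at hB
    by_cases hz : z ∈ C
    · exact ih hB.2 hz hy
    · exact ⟨x, z, hx, hB.2 _ p.start_mem_support, hz, h⟩

theorem aux_hit {V : Type*} (G : SimpleGraph V) {C : Set V} {x y : V} (p : G.Walk x y)
    (hp : p.IsPath) (hy : y ∈ C) :
    ∃ (b : V) (q : G.Walk x b), b ∈ C ∧ q.IsPath ∧ (∀ w ∈ q.support, w ∈ p.support) ∧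
      ∀ w ∈ q.support, w ∈ C → w = b := by
  induction p with
  | nil => exact ⟨_, Walk.nil, hy, by simp, by simp, by simp⟩
  | @cons x z y h p ih =>
    by_cases hx : x ∈ C
    · exact ⟨x, Walk.nil, hx, by simp, by simp, by simp⟩
    · rw [Walk.cons_isPath_iff] at hp
      obtain ⟨b, q, hb, hq, hs, hh⟩ := ih hp.1 hy
      refine ⟨b, Walk.cons h q, hb, ?_, ?_, ?_⟩
      · rw [Walk.cons_isPath_iff]
        exact ⟨hq, fun hc => hp.2 (hs _ hc)⟩
      · simp only [Walk.support_cons, List.mem_cons]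
        rintro w (rfl | hw)
        · exact Or.inl rfl
        · exact Or.inr (hs _ hw)
      · simp only [Walk.support_cons, List.mem_cons]
        rintro w (rfl | hw) hwC
        · exact absurd hwC hx
        · exact hh w hw hwC

theorem aux_append {V : Type*} (G : SimpleGraph V) {x b a : V} (p : G.Walk x b) (q : G.Walk b a)
    (hp : p.IsPath) (hq : q.IsPath) (h : ∀ w ∈ p.support, w ∈ q.support → w = b) :
    (p.append q).IsPath := by
  induction p with
  | nil => simpa using hq
  | @cons x z y hxz p ih =>
    rw [Walk.cons_isPath_iff] at hp
    simp only [Walk.support_cons, List.mem_cons, forall_eq_or_imp] at h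
    rw [Walk.cons_append, Walk.cons_isPath_iff]
    refine ⟨ih _ hp.1 hq h.2, ?_⟩
    rw [Walk.mem_support_append_iff]
    rintro (h1 | h1)
    · exact hp.2 h1
    · exact hp.2 (by rw [h.1 h1]; exact p.end_mem_support)

theorem aux_card {V : Type*} (G : SimpleGraph V) {a : V} (c : G.Walk a a) (hc : c.IsCycle)
    (h : IsOddCycleSet G {x | x ∈ c.support}) : Odd c.length := by
  classical
  obtain ⟨n, hn, -, ⟨e⟩⟩ := h
  have h1 : Nat.card {x | x ∈ c.support} = n := by
    rw [Nat.card_congr e.toEquiv]; simp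
  have h2 : {x | x ∈ c.support} = (c.support.tail.toFinset : Set V) := by
    ext x
    simp only [Set.mem_ofPred_eq, List.coe_toFinset]
    constructor
    · intro hx
      rw [Walk.mem_support_iff] at hx
      rcases hx with rfl | hx
      · exact Walk.end_mem_tail_support hc.not_nil
      · exact hx
    · exact fun hx => List.mem_of_mem_tail hx
  rw [h2] at h1
  have h3 : c.support.tail.toFinset.card = n := by
    rw [← h1, Nat.card_coe_set_eq, Set.ncard_coe_finset]
  rw [List.toFinset_card_of_nodup hc.support_nodup] at h3
  simp at h3
  rw [h3]; exact hn

theorem aux_deg {V : Type*} (G : SimpleGraph V) {S : Set V} (h : IsOddCycleSet G S)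
    {a x y z : V} (ha : a ∈ S) (hx : x ∈ S) (hy : y ∈ S) (hz : z ∈ S)
    (hax : G.Adj a x) (hay : G.Adj a y) (haz : G.Adj a z) (hxy : x ≠ y) (hxz : x ≠ z)
    (hyz : y ≠ z) : False := by
  obtain ⟨n, -, hn, ⟨e⟩⟩ := h
  obtain ⟨m, rfl⟩ : ∃ m, n = m + 2 := ⟨n - 2, by omega⟩
  have key : ∀ w (hw : w ∈ S), G.Adj a w →
      e ⟨w, hw⟩ = e ⟨a, ha⟩ - 1 ∨ e ⟨w, hw⟩ = e ⟨a, ha⟩ + 1 := by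
    intro w hw haw
    have : (cycleGraph (m+2)).Adj (e ⟨a, ha⟩) (e ⟨w, hw⟩) := by
      rw [e.map_adj_iff]; exact haw
    have h2 : e ⟨w, hw⟩ ∈ (cycleGraph (m+2)).neighborSet (e ⟨a, ha⟩) := this
    rw [cycleGraph_neighborSet] at h2
    simpa using h2
  have inj : ∀ u w (hu : u ∈ S) (hw : w ∈ S), e ⟨u, hu⟩ = e ⟨w, hw⟩ → u = w := by
    intro u w hu hw h
    simpa using e.injective h
  rcases key x hx hax with h1 | h1 <;> rcases key y hy hay with h2 | h2 <;>
    rcases key z hz haz with h3 | h3 <;>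
    first
    | exact hxy (inj _ _ hx hy (h1.trans h2.symm))
    | exact hxz (inj _ _ hx hz (h1.trans h3.symm))
    | exact hyz (inj _ _ hy hz (h2.trans h3.symm))

/-- glue an ear to an arc -/
theorem aux_glue {V : Type*} (G : SimpleGraph V) {C : Set V} {a v b : V} (hav : G.Adj a v)
    (hv : v ∉ C) (p : G.Walk v b) (hp : p.IsPath) (hpa : a ∉ p.support)
    (hpC : ∀ w ∈ p.support, w ∈ C → w = b) (q : G.Walk b a) (hq : q.IsPath)
    (hqC : ∀ w ∈ q.support, w ∈ C) : (Walk.cons hav (p.append q)).IsCycle := by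
  rw [Walk.cons_isCycle_iff]
  refine ⟨aux_append G p q hp hq fun w h1 h2 => hpC w h1 (hqC w h2), ?_⟩
  rw [Walk.edges_append, List.mem_append]
  rintro (h | h)
  · exact hpa (Walk.fst_mem_support_of_mem_edges _ h)
  · exact hv (hqC _ (Walk.snd_mem_support_of_mem_edges _ h))

/-- long arc case -/
theorem aux_long {V : Type*} (G : SimpleGraph V) {a v : V} (c : G.Walk a a) (hc : c.IsCycle)
    (hcl : ¬ G.IsClique {x | x ∈ c.support}) (hav : G.Adj a v) (hv : v ∉ c.support)
    (p : G.Walk v c.snd) (hp : p.IsPath) (hpa : a ∉ p.support)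
    (hpC : ∀ w ∈ p.support, w ∈ c.support → w = c.snd) :
    ∃ (v : V) (c : G.Walk v v), IsNonCliqueNonOddCycle G c := by
  have hts : c.tail.support = c.support.tail := Walk.support_tail_of_not_nil c hc.not_nil
  have hall : ∀ x ∈ c.support, x ∈ c.tail.support := by
    intro x hx
    rw [Walk.mem_support_iff] at hx
    rcases hx with rfl | hx
    · exact Walk.end_mem_support _
    · rw [hts]; exact hx
  have hd := aux_glue G (C := {x | x ∈ c.support}) hav hv p hp hpa hpC c.tail hc.isPath_tail
    (fun w hw => by rw [hts] at hw; exact List.mem_of_mem_tail hw)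
  have hsub : ∀ x ∈ c.support, x ∈ (Walk.cons hav (p.append c.tail)).support := by
    intro x hx
    rw [Walk.support_cons, List.mem_cons, Walk.mem_support_append_iff]
    exact Or.inr (Or.inr (hall x hx))
  refine ⟨a, _, hd, fun h => hcl (h.subset hsub), fun h => ?_⟩
  have hs : c.snd ∈ c.support := Walk.getVert_mem_support _ _
  have ht : c.penultimate ∈ c.support := Walk.getVert_mem_support _ _
  refine aux_deg G h (a := a) (x := v) (y := c.snd) (z := c.penultimate) (hsub _ c.start_mem_support)
    ?_ (hsub _ hs) (hsub _ ht) hav (c.adj_snd hc.not_nil) (c.adj_penultimate hc.not_nil).symm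
    ?_ ?_ hc.snd_ne_penultimate
  · show v ∈ (Walk.cons hav (p.append c.tail)).support
    rw [Walk.support_cons, List.mem_cons, Walk.mem_support_append_iff]
    exact Or.inr (Or.inl p.start_mem_support)
  · rintro rfl; exact hv hs
  · rintro rfl; exact hv ht

theorem aux_main {V : Type*} (G : SimpleGraph V) {a v b : V} (c : G.Walk a a) (hc : c.IsCycle)
    (hcl : ¬ G.IsClique {x | x ∈ c.support}) (hav : G.Adj a v) (hv : v ∉ c.support)
    (hb : b ∈ c.support)
    (p : G.Walk v b) (hp : p.IsPath) (hpa : a ∉ p.support)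
    (hpC : ∀ w ∈ p.support, w ∈ c.support → w = b) :
    ∃ (v : V) (c : G.Walk v v), IsNonCliqueNonOddCycle G c := by
  classical
  by_cases hodd : IsOddCycleSet G {x | x ∈ c.support}
  swap
  · exact ⟨a, c, hc, hcl, hodd⟩
  have hab : a ≠ b := by rintro rfl; exact hpa p.end_mem_support
  by_cases hadj : G.Adj a b
  · by_cases h1 : b = c.snd
    · subst h1
      exact aux_long G c hc hcl hav hv p hp hpa hpC
    by_cases h2 : b = c.penultimate
    · have h3 : c.reverse.snd = b := by rw [h2]; simp
      subst h3
      exact aux_long G c.reverse hc.reverse (by simpa using hcl) hav (by simpa using hv) p hp hpa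
        (by simpa using hpC)
    · exact (aux_deg G hodd (a := a) c.start_mem_support hb
        (Walk.getVert_mem_support c 1 : c.snd ∈ c.support)
        (Walk.getVert_mem_support c _ : c.penultimate ∈ c.support) hadj
        (c.adj_snd hc.not_nil) (c.adj_penultimate hc.not_nil).symm h1 h2
        hc.snd_ne_penultimate).elim
  · have hol := aux_card G c hc hodd
    have fin : ∀ q : G.Walk b a, q.IsPath → (∀ w ∈ q.support, w ∈ c.support) →
        Odd (p.length + q.length) →
        ∃ (v : V) (c : G.Walk v v), IsNonCliqueNonOddCycle G c := by
      intro q hq hqC hl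
      have hd := aux_glue G (C := {x | x ∈ c.support}) hav hv p hp hpa hpC q hq hqC
      refine ⟨a, _, hd, fun h => ?_, fun h => ?_⟩
      · refine hadj (h (Walk.start_mem_support _) ?_ hab)
        show b ∈ (Walk.cons hav (p.append q)).support
        rw [Walk.support_cons, List.mem_cons, Walk.mem_support_append_iff]
        exact Or.inr (Or.inl p.end_mem_support)
      · have := aux_card G _ hd h
        rw [Walk.length_cons, Walk.length_append] at this
        grind
    have hlen : (c.takeUntil b hb).length + (c.dropUntil b hb).length = c.length := by
      rw [← Walk.length_append, Walk.take_spec]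
    by_cases hpar : Odd (p.length + (c.dropUntil b hb).length)
    · refine fin _ ?_ (fun w hw => Walk.support_dropUntil_subset_support _ hb hw) hpar
      have hc2 : ((c.takeUntil b hb).append (c.dropUntil b hb)).IsCycle := by
        rw [Walk.take_spec]; exact hc
      exact hc2.isPath_of_append_right (Walk.not_nil_of_ne hab)
    · refine fin (c.takeUntil b hb).reverse (hc.isPath_takeUntil hb).reverse ?_ ?_
      · intro w hw
        rw [Walk.support_reverse, List.mem_reverse] at hw
        exact Walk.support_takeUntil_subset_support _ hb hw
      · rw [Walk.length_reverse]
        grind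

/-- Every connected finite simple graph that is not a Gallai tree contains a cycle whose
vertex set induces neither a complete graph nor an odd cycle. -/
theorem exists_nonclique_nonoddcycle_cycle {V : Type*} [Fintype V] (G : SimpleGraph V)
    (hconn : G.Connected) (hG : ¬ IsGallaiTree G) :
    ∃ (v : V) (c : G.Walk v v), IsNonCliqueNonOddCycle G c := by
  classical
  unfold IsGallaiTree at hG
  push Not at hG
  obtain ⟨B, ⟨hBc, hcut, -⟩, hBcl, hBodd⟩ := hG
  have hex : ∃ x ∈ B, ∃ y ∈ B, x ≠ y ∧ ¬ G.Adj x y := by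
    by_contra hcon
    push Not at hcon
    exact hBcl fun x hx y hy hxy => hcon x hx y hy hxy
  obtain ⟨x, hx, y, hy, hxy, hnxy⟩ := hex
  have hcut' : ∀ z ∈ B, (G.induce (B \ {z})).Connected := by
    intro z hz
    rcases hcut z hz with h | h
    · rw [h] at hx hy
      exact absurd (hx.trans hy.symm) hxy
    · exact h
  obtain ⟨p0, -, hp0⟩ := aux_path G hBc hx hy
  obtain ⟨u, z, w, hu, hz, hw, huz, hzw, huw, hnuw⟩ := aux_p3 G p0 hp0 hxy hnxy
  obtain ⟨p, hp, hpB⟩ := aux_path G (hcut' z hz) (x := u) (y := w) ⟨hu, huz.ne⟩ ⟨hw, hzw.ne'⟩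
  have hzp : z ∉ p.support := fun h => (hpB z h).2 rfl
  obtain ⟨c, hc, hcl, hcB⟩ : ∃ c : G.Walk z z, c.IsCycle ∧ ¬ G.IsClique {x | x ∈ c.support} ∧
      ∀ t ∈ c.support, t ∈ B := by
    have hd := aux_glue G (C := {z, w}) huz.symm (v := u) (by simp [huz.ne, huw]) p hp hzp
      (by
        rintro t ht (rfl | h)
        · exact absurd ht hzp
        · exact h) (Walk.cons hzw.symm Walk.nil) (by simp [hzw.ne']) (by simp)
    refine ⟨_, hd, fun h => hnuw (h ?_ ?_ huw), ?_⟩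
    · simp
    · simp
    · intro t ht
      simp only [Walk.support_cons, List.mem_cons, Walk.mem_support_append_iff,
        Walk.support_nil, List.not_mem_nil, or_false] at ht
      rcases ht with rfl | ht | rfl | rfl
      · exact hz
      · exact (hpB t ht).1
      · exact hw
      · exact hz
  by_cases hodd : IsOddCycleSet G {x | x ∈ c.support}
  swap
  · exact ⟨z, c, hc, hcl, hodd⟩
  have hne : ∃ t ∈ B, t ∉ c.support := by
    by_contra hcon
    push Not at hcon
    apply hBodd
    have : B = {x | x ∈ c.support} := Set.Subset.antisymm hcon hcB
    rw [this]; exact hodd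
  obtain ⟨t, ht, htc⟩ := hne
  obtain ⟨p1, -, hp1⟩ := aux_path G hBc hz ht
  obtain ⟨a, v, ha, hv, hvc, hav⟩ := aux_boundary G (C := {x | x ∈ c.support}) p1 hp1
    c.start_mem_support htc
  have hmem : ∀ s, s ∈ (c.rotate a ha).support ↔ s ∈ c.support := by
    intro s; exact Walk.mem_support_rotate_iff ..
  have hset : {x | x ∈ (c.rotate a ha).support} = {x | x ∈ c.support} := by
    ext s; exact hmem s
  obtain ⟨c', hc', hs'⟩ : ∃ c' : G.Walk a a, c'.IsCycle ∧
    {x | x ∈ c'.support} = {x | x ∈ c.support} := ⟨c.rotate a ha, hc.rotate ha, hset⟩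
  have hm : ∀ s, s ∈ c'.support ↔ s ∈ c.support := fun s => Set.ext_iff.1 hs' s
  have hsn : c'.snd ∈ c'.support := Walk.getVert_mem_support _ _
  obtain ⟨p2, hp2, hp2B⟩ := aux_path G (hcut' a (hcB a ha)) (x := v) (y := c'.snd)
    ⟨hv, hav.ne'⟩ ⟨hcB _ ((hm _).1 hsn), (c'.adj_snd hc'.not_nil).ne'⟩
  obtain ⟨b, q, hb, hq, hqp, hqC⟩ := aux_hit G (C := {x | x ∈ c'.support}) p2 hp2 hsn
  exact aux_main G c' hc' (by rw [hs']; exact hcl) hav (fun h => hvc ((hm _).1 h)) hb q hq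
    (fun h => (hp2B a (hqp a h)).2 rfl) hqC
end

section
/- Let G be a connected finite simple graph that is not a Gallai tree, and let C = v_1 … v_ℓ be a shortest cycle in G whose vertex set induces neither a complete graph nor an odd cycle. If ℓ ≥ 5, then no vertex of C is adjacent in G to all other vertices of C. -/
lemma aux_not_odd {V : Type*} (G : SimpleGraph V) (B : Set V) (x y1 y2 y3 : V)
    (hx : x ∈ B) (h1 : y1 ∈ B) (h2 : y2 ∈ B) (h3 : y3 ∈ B)
    (a1 : G.Adj x y1) (a2 : G.Adj x y2) (a3 : G.Adj x y3)
    (n12 : y1 ≠ y2) (n13 : y1 ≠ y3) (n23 : y2 ≠ y3) : ¬ IsOddCycleSet G B := by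
  rintro ⟨n, -, hn, ⟨f⟩⟩
  obtain ⟨m, rfl⟩ : ∃ m, n = m + 2 := ⟨n - 2, by omega⟩
  have key : ∀ y (hy : y ∈ B), G.Adj x y →
      f ⟨y, hy⟩ = f ⟨x, hx⟩ - 1 ∨ f ⟨y, hy⟩ = f ⟨x, hx⟩ + 1 := by
    intro y hy h
    have h' : (G.induce B).Adj ⟨x, hx⟩ ⟨y, hy⟩ := h
    rw [← f.map_adj_iff, SimpleGraph.cycleGraph_adj] at h'
    rcases h' with h' | h'
    · left; rw [← h']; abel
    · right; rw [← h']; abel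
  have inj : ∀ y z (hy : y ∈ B) (hz : z ∈ B), f ⟨y, hy⟩ = f ⟨z, hz⟩ → y = z := by
    intro y z hy hz h
    simpa using f.injective h
  rcases key y1 h1 a1 with k1 | k1 <;> rcases key y2 h2 a2 with k2 | k2 <;>
    rcases key y3 h3 a3 with k3 | k3 <;>
  first
    | exact n12 (inj _ _ h1 h2 (k1.trans k2.symm))
    | exact n13 (inj _ _ h1 h3 (k1.trans k3.symm))
    | exact n23 (inj _ _ h2 h3 (k2.trans k3.symm))

lemma aux_key {V : Type*} (G : SimpleGraph V) (L : ℕ)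
    (hmin : ∀ (u : V) (c' : G.Walk u u), IsNonCliqueNonOddCycle G c' → L ≤ c'.length)
    (x a b : V) (q : G.Walk a b) (hq : q.IsPath) (hx : x ∉ q.support)
    (hadj : ∀ y ∈ q.support, G.Adj x y) (h2 : 2 ≤ q.length) (hL : q.length + 2 < L) :
    ∀ u ∈ q.support, ∀ w ∈ q.support, u ≠ w → G.Adj u w := by
  have ha := hadj a q.start_mem_support
  have hb := (hadj b q.end_mem_support).symm
  by_contra hcon
  have := hmin x (SimpleGraph.Walk.cons ha (q.concat hb)) ⟨?_, ?_, ?_⟩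
  · simp at this; omega
  · rw [SimpleGraph.Walk.cons_isCycle_iff, SimpleGraph.Walk.concat_isPath_iff]
    refine ⟨⟨hq, hx⟩, ?_⟩
    rw [SimpleGraph.Walk.edges_concat]
    intro h
    simp only [List.concat_eq_append, List.mem_append, List.mem_singleton] at h
    rcases h with h | h
    · exact hx (q.fst_mem_support_of_mem_edges h)
    · have hab : a = b := by
        rcases Sym2.eq_iff.1 h with ⟨h, h'⟩ | ⟨h, h'⟩
        · exact h'.trans h
        · exact h'
      subst hab
      rw [SimpleGraph.Walk.isPath_iff_eq_nil] at hq
      subst hq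
      simp at h2
  · intro hcl
    apply hcon
    intro u hu w hw huw
    exact hcl (by simp [SimpleGraph.Walk.support_concat, hu])
      (by simp [SimpleGraph.Walk.support_concat, hw]) huw
  · have hne : ∀ i j, i ≤ 2 → j ≤ 2 → i ≠ j → q.getVert i ≠ q.getVert j := by
      intro i j hi hj hij h
      exact hij (hq.getVert_injOn (by simp; omega) (by simp; omega) h)
    have hm : ∀ i, q.getVert i ∈ q.support := fun i => q.getVert_mem_support i
    refine aux_not_odd G _ x (q.getVert 0) (q.getVert 1) (q.getVert 2) ?_ ?_ ?_ ?_
      (hadj _ (hm 0)) (hadj _ (hm 1)) (hadj _ (hm 2))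
      (hne 0 1 (by omega) (by omega) (by omega)) (hne 0 2 (by omega) (by omega) (by omega))
      (hne 1 2 (by omega) (by omega) (by omega))
    · simp
    · simp [SimpleGraph.Walk.support_concat]
    · simp [SimpleGraph.Walk.support_concat, hm 1]
    · simp [SimpleGraph.Walk.support_concat, hm 2]

lemma aux_main_s2 {V : Type*} (G : SimpleGraph V) (L : ℕ)
    (hmin : ∀ (u : V) (c' : G.Walk u u), IsNonCliqueNonOddCycle G c' → L ≤ c'.length)
    (x a b : V) (q : G.Walk a b) (hq : q.IsPath) (hx : x ∉ q.support)
    (hadj : ∀ y ∈ q.support, G.Adj x y) (h2 : 3 ≤ q.length) (hL : q.length + 2 = L) :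
    ∀ u ∈ q.support, ∀ w ∈ q.support, u ≠ w → G.Adj u w := by
  cases q with
  | nil => simp at h2
  | @cons _ s _ h p =>
    obtain ⟨t, q1, h1, he⟩ := SimpleGraph.Walk.exists_cons_eq_concat h p
    have hlen := congrArg SimpleGraph.Walk.length he
    simp only [SimpleGraph.Walk.length_concat, SimpleGraph.Walk.length_cons] at hlen h2 hL
    have hs : ∀ y, y ∈ (SimpleGraph.Walk.cons h p).support ↔ y ∈ q1.support ∨ y = b := by
      intro y; rw [he]; simp [SimpleGraph.Walk.support_concat]
    have hs' : ∀ y, y ∈ (SimpleGraph.Walk.cons h p).support ↔ y = a ∨ y ∈ p.support := by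
      intro y; simp
    have hp1 : q1.IsPath := by
      rw [he, SimpleGraph.Walk.concat_isPath_iff] at hq; exact hq.1
    obtain ⟨hp, hap⟩ := (SimpleGraph.Walk.cons_isPath_iff _ _).1 hq
    have k1 := aux_key G L hmin x _ _ q1 hp1 (fun hh => hx ((hs x).2 (Or.inl hh)))
      (fun y hy => hadj y ((hs y).2 (Or.inl hy))) (by omega) (by omega)
    have k2 := aux_key G L hmin x _ _ p hp (fun hh => hx ((hs' x).2 (Or.inr hh)))
      (fun y hy => hadj y ((hs' y).2 (Or.inr hy))) (by omega) (by omega)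
    have hsb : s ≠ b := by
      rintro rfl
      rw [SimpleGraph.Walk.isPath_iff_eq_nil] at hp
      subst hp
      simp at h2
    have hab : a ≠ b := by
      rintro rfl; exact hap p.end_mem_support
    have hsb' : G.Adj s b := k2 s p.start_mem_support b p.end_mem_support hsb
    have k3 : G.Adj a b := by
      refine aux_key G L hmin x a b
        (SimpleGraph.Walk.cons h (SimpleGraph.Walk.cons hsb' SimpleGraph.Walk.nil)) ?_ ?_ ?_
        (by simp) (by simp; omega) a (by simp) b (by simp) hab
      · simp [SimpleGraph.Walk.cons_isPath_iff, hsb, hab, h.ne]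
      · have e1 : x ≠ a := fun e => hx ((hs' x).2 (Or.inl e))
        have e2 : x ≠ s := fun e => hx ((hs' x).2 (Or.inr (e ▸ p.start_mem_support)))
        have e3 : x ≠ b := fun e => hx ((hs x).2 (Or.inr e))
        simp [e1, e2, e3]
      · intro y hy
        apply hadj
        rw [hs']
        simp only [SimpleGraph.Walk.support_cons, SimpleGraph.Walk.support_nil,
          List.mem_cons, List.not_mem_nil, or_false] at hy
        rcases hy with rfl | rfl | rfl
        · exact Or.inl rfl
        · exact Or.inr p.start_mem_support
        · exact Or.inr p.end_mem_support
    intro u hu w hw huw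
    have hu1 := (hs u).1 hu
    have hu2 := (hs' u).1 hu
    have hw1 := (hs w).1 hw
    have hw2 := (hs' w).1 hw
    have k3' := k3.symm
    have bp := p.end_mem_support
    have aq := q1.start_mem_support
    grind

theorem no_vertex_adjacent_to_all {V : Type*} [Fintype V] (G : SimpleGraph V)
    (hconn : G.Connected) (hG : ¬ IsGallaiTree G) (v : V) (c : G.Walk v v)
    (hc : IsNonCliqueNonOddCycle G c)
    (hmin : ∀ (u : V) (c' : G.Walk u u), IsNonCliqueNonOddCycle G c' →
      c.length ≤ c'.length)
    (hlen : 5 ≤ c.length) :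
    ∀ x ∈ c.support, ¬ (∀ y ∈ c.support, y ≠ x → G.Adj x y) := by
  classical
  intro x hx hadj
  obtain ⟨hcyc, hncl, -⟩ := hc
  obtain ⟨d, hd, hdl, hds⟩ : ∃ d : G.Walk x x, d.IsCycle ∧ d.length = c.length ∧
      ∀ y, y ∈ d.support ↔ y ∈ c.support :=
    ⟨c.rotate x hx, hcyc.rotate hx, by simp, fun y => by simp⟩
  cases d with
  | nil => simp at hdl; omega
  | @cons _ a _ h p =>
    cases p with
    | nil => simp at hdl; omega
    | @cons _ s _ h' p' =>
      obtain ⟨b, q, hb, he⟩ := SimpleGraph.Walk.exists_cons_eq_concat h' p'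
      rw [he] at hd hdl hds
      rw [SimpleGraph.Walk.cons_isCycle_iff, SimpleGraph.Walk.concat_isPath_iff] at hd
      obtain ⟨⟨hq, hxq⟩, -⟩ := hd
      simp only [SimpleGraph.Walk.length_concat, SimpleGraph.Walk.length_cons] at hdl
      have hds' : ∀ y, y ∈ c.support ↔ y = x ∨ y ∈ q.support := by
        intro y; rw [← hds]; simp [SimpleGraph.Walk.support_concat]; tauto
      have hadj' : ∀ y ∈ q.support, G.Adj x y := fun y hy =>
        hadj y ((hds' y).2 (Or.inr hy)) (fun e => hxq (e ▸ hy))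
      have k := aux_main_s2 G c.length hmin x a b q hq hxq hadj' (by omega) (by omega)
      apply hncl
      intro u hu w hw huw
      rcases (hds' u).1 hu with rfl | hu' <;> rcases (hds' w).1 hw with rfl | hw'
      · exact absurd rfl huw
      · exact hadj' _ hw'
      · exact (hadj' _ hu').symm
      · exact k u hu' w hw' huw
end

section
/- Let G be a connected finite simple graph that is not a Gallai tree, and let C = v_1 … v_ℓ be a shortest cycle in G whose vertex set induces neither a complete graph nor an odd cycle. Then each vertex of C is incident with at most one chord of C. -/
theorem aux_path_s3 {V : Type*} (G : SimpleGraph V) (w : ℕ → V) (m : ℕ)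
    (hinj : ∀ a b, a ≤ m → b ≤ m → w a = w b → a = b)
    (hadj : ∀ k, k < m → G.Adj (w k) (w (k+1))) :
    ∃ p : G.Walk (w 0) (w m), p.IsPath ∧ p.length = m ∧
      (∀ x, x ∈ p.support ↔ ∃ k ≤ m, w k = x) ∧
      (∀ e ∈ p.edges, ∃ k < m, e = s(w k, w (k+1))) := by
  induction m with
  | zero =>
    refine ⟨SimpleGraph.Walk.nil, by simp, by simp, ?_, by simp⟩
    intro x
    simp [eq_comm]
  | succ m ih =>
    obtain ⟨p, hp, hl, hs, he⟩ := ih (fun a b ha hb => hinj a b (by omega) (by omega))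
      (fun k hk => hadj k (by omega))
    refine ⟨p.concat (hadj m (by omega)), ?_, by simp [hl], ?_, ?_⟩
    · refine hp.concat ?_ _
      rw [hs]
      rintro ⟨k, hk, h⟩
      have := hinj _ _ (by omega) (by omega) h
      omega
    · intro x
      rw [SimpleGraph.Walk.support_concat, List.mem_append, hs]
      constructor
      · rintro (⟨k, hk, h⟩ | h)
        · exact ⟨k, by omega, h⟩
        · exact ⟨m+1, le_rfl, by simpa [eq_comm] using h⟩
      · rintro ⟨k, hk, h⟩
        rcases Nat.lt_or_ge m k with h1 | h1
        · right
          have : k = m + 1 := by omega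
          subst this
          simp [h]
        · exact Or.inl ⟨k, h1, h⟩
    · intro e hh
      rw [SimpleGraph.Walk.edges_concat, List.concat_eq_append, List.mem_append] at hh
      rcases hh with hh | hh
      · obtain ⟨k, hk, h⟩ := he e hh
        exact ⟨k, by omega, h⟩
      · exact ⟨m, by omega, by simpa using hh⟩

theorem aux_deg_s3 {V : Type*} (G : SimpleGraph V) (B : Set V) (x a b c : V)
    (hx : x ∈ B) (ha : a ∈ B) (hb : b ∈ B) (hc : c ∈ B)
    (hab : a ≠ b) (hac : a ≠ c) (hbc : b ≠ c)
    (h1 : G.Adj x a) (h2 : G.Adj x b) (h3 : G.Adj x c) : ¬ IsOddCycleSet G B := by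
  rintro ⟨n, -, hn, ⟨f⟩⟩
  obtain ⟨n, rfl⟩ : ∃ m, n = m + 3 := ⟨n - 3, by omega⟩
  have hd := SimpleGraph.cycleGraph_degree_three_le (n := n) (v := f ⟨x, hx⟩)
  have hsub : ({f ⟨a, ha⟩, f ⟨b, hb⟩, f ⟨c, hc⟩} : Finset (Fin (n+3))) ⊆
      (SimpleGraph.cycleGraph (n+3)).neighborFinset (f ⟨x, hx⟩) := by
    intro y hy
    simp only [Finset.mem_insert, Finset.mem_singleton] at hy
    rw [SimpleGraph.mem_neighborFinset]
    rcases hy with rfl | rfl | rfl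
    · exact f.map_rel_iff.2 h1
    · exact f.map_rel_iff.2 h2
    · exact f.map_rel_iff.2 h3
  have hcard := Finset.card_le_card hsub
  rw [SimpleGraph.card_neighborFinset_eq_degree, hd, Finset.card_eq_three.2
    ⟨_, _, _, ?_, ?_, ?_, rfl⟩] at hcard
  · omega
  · simpa using hab
  · simpa using hac
  · simpa using hbc

theorem aux_clique {V : Type*} (G : SimpleGraph V) (l : ℕ)
    (hmin : ∀ (u : V) (c' : G.Walk u u), IsNonCliqueNonOddCycle G c' → l ≤ c'.length)
    (w : ℕ → V) (m : ℕ) (hm : m + 1 < l)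
    (hinj : ∀ a b, a ≤ m → b ≤ m → w a = w b → a = b)
    (hadj : ∀ k, k < m → G.Adj (w k) (w (k+1)))
    (hcl : G.Adj (w m) (w 0)) (i : ℕ) (hi : 2 ≤ i) (hi2 : i < m) (hch : G.Adj (w 0) (w i)) :
    ∀ a b, a ≤ m → b ≤ m → a ≠ b → G.Adj (w a) (w b) := by
  obtain ⟨p, hp, hl, hs, he⟩ := aux_path_s3 G w m hinj hadj
  by_contra hcon
  have hset : ∀ x, x ∈ (SimpleGraph.Walk.cons hcl p).support ↔ ∃ k ≤ m, w k = x := by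
    intro x
    rw [SimpleGraph.Walk.support_cons, List.mem_cons, hs]
    constructor
    · rintro (rfl | h)
      · exact ⟨m, le_rfl, rfl⟩
      · exact h
    · exact Or.inr
  have := hmin _ (SimpleGraph.Walk.cons hcl p) ⟨?_, ?_, ?_⟩
  · rw [SimpleGraph.Walk.length_cons] at this
    omega
  · rw [SimpleGraph.Walk.cons_isCycle_iff]
    refine ⟨hp, fun h => ?_⟩
    obtain ⟨k, hk, h⟩ := he _ h
    rw [Sym2.eq_iff] at h
    rcases h with ⟨h1, h2⟩ | ⟨h1, h2⟩
    · have := hinj _ _ (by omega) (by omega) h1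
      omega
    · have := hinj _ _ (by omega) (by omega) h1
      have := hinj _ _ (by omega) (by omega) h2
      omega
  · intro hq
    apply hcon
    intro a b ha hb hab
    exact hq ((hset _).2 ⟨a, ha, rfl⟩) ((hset _).2 ⟨b, hb, rfl⟩)
      (fun h => hab (hinj _ _ ha hb h))
  · refine aux_deg_s3 G _ (w 0) (w 1) (w i) (w m) ((hset _).2 ⟨0, by omega, rfl⟩)
      ((hset _).2 ⟨1, by omega, rfl⟩) ((hset _).2 ⟨i, by omega, rfl⟩)
      ((hset _).2 ⟨m, by omega, rfl⟩) ?_ ?_ ?_ (hadj 0 (by omega)) hch hcl.symm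
    all_goals
      intro h
      have := hinj _ _ (by omega) (by omega) h
      omega

theorem aux_comb {V : Type*} (G : SimpleGraph V) (l : ℕ)
    (hmin : ∀ (u : V) (c' : G.Walk u u), IsNonCliqueNonOddCycle G c' → l ≤ c'.length)
    (v : ℕ → V)
    (hinj : ∀ a b, a < l → b < l → v a = v b → a = b)
    (hadj : ∀ k, k + 1 < l → G.Adj (v k) (v (k+1)))
    (hcl : G.Adj (v (l-1)) (v 0)) (i j : ℕ) (hi : 2 ≤ i) (hij : i < j) (hj : j + 1 < l)
    (h0i : G.Adj (v 0) (v i)) (h0j : G.Adj (v 0) (v j)) :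
    ∀ a b, a < l → b < l → a ≠ b → G.Adj (v a) (v b) := by
  -- cycles through the front part
  have front : ∀ i j, 2 ≤ i → i < j → j + 1 < l → G.Adj (v 0) (v i) → G.Adj (v 0) (v j) →
      ∀ a b, a ≤ j → b ≤ j → a ≠ b → G.Adj (v a) (v b) := by
    intro i j hi hij hj h0i h0j
    exact aux_clique G l hmin v j hj (fun a b ha hb => hinj a b (by omega) (by omega))
      (fun k hk => hadj k (by omega)) h0j.symm i hi hij h0i
  have back : ∀ i j, 2 ≤ i → i < j → j + 1 < l → G.Adj (v 0) (v i) → G.Adj (v 0) (v j) →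
      ∀ a b, (a = 0 ∨ i ≤ a) → a < l → (b = 0 ∨ i ≤ b) → b < l → a ≠ b →
        G.Adj (v a) (v b) := by
    intro i j hi hij hj h0i h0j a b ha hal hb hbl hab
    have key := aux_clique G l hmin (fun k => v (if k = 0 then 0 else k + i - 1)) (l - i)
      (by omega) ?_ ?_ ?_ (j - i + 1) (by omega) (by omega) ?_
      (if a = 0 then 0 else a - i + 1) (if b = 0 then 0 else b - i + 1)
      (by split_ifs <;> omega) (by split_ifs <;> omega) (by split_ifs <;> omega)
    · have e : ∀ a, (a = 0 ∨ i ≤ a) → (if (if a = 0 then 0 else a - i + 1) = 0 then 0 else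
          (if a = 0 then 0 else a - i + 1) + i - 1) = a := by
        intro a ha
        by_cases h : a = 0
        · simp [h]
        · simp only [h, if_false, Nat.add_eq_zero_iff, one_ne_zero, and_false]
          omega
      simp only [e a ha, e b hb] at key
      exact key
    · intro a b ha hb h
      have := hinj _ _ (by split_ifs <;> omega) (by split_ifs <;> omega) h
      split_ifs at this <;> omega
    · intro k hk
      rcases Nat.eq_zero_or_pos k with rfl | hk0
      · simpa using h0i
      · have := hadj (k + i - 1) (by omega)
        simp only [show k ≠ 0 by omega, if_false, Nat.add_eq_zero_iff, false_and]
        rwa [show k + 1 + i - 1 = k + i - 1 + 1 by omega]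
    · simp only [show l - i ≠ 0 by omega, if_false, if_true]
      rwa [show l - i + i - 1 = l - 1 by omega]
    · simp only [Nat.add_eq_zero_iff, one_ne_zero, and_false, if_false, if_true]
      rwa [show j - i + 1 + i - 1 = j by omega]
  have z : ∀ b, b < l → b ≠ 0 → G.Adj (v 0) (v b) := by
    intro b hb hb0
    rcases Nat.lt_or_ge b i with h | h
    · exact front i j hi hij hj h0i h0j 0 b (by omega) (by omega) (by omega)
    · exact back i j hi hij hj h0i h0j 0 b (by omega) (by omega) (by omega) (by omega) (by omega)
  have F := front 2 (l-2) le_rfl (by omega) (by omega) (z _ (by omega) (by omega))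
    (z _ (by omega) (by omega))
  have B := back 2 (l-2) le_rfl (by omega) (by omega) (z _ (by omega) (by omega))
    (z _ (by omega) (by omega))
  have L : G.Adj (v 1) (v (l-1)) := by
    have := aux_clique G l hmin (fun k => v (if k < 3 then k else l - 1)) 3 (by omega)
      (by
        intro a b ha hb h
        have := hinj _ _ (by split_ifs <;> omega) (by split_ifs <;> omega) h
        split_ifs at this <;> omega)
      (by
        intro k hk
        interval_cases k
        · simpa using hadj 0 (by omega)
        · simpa using hadj 1 (by omega)
        · simpa using B 2 (l-1) (by omega) (by omega) (by omega) (by omega) (by omega))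
      (by simpa using hcl) 2 le_rfl (by omega) (by simpa using z 2 (by omega) (by omega))
      1 3 (by omega) (by omega) (by omega)
    simpa using this
  have W : ∀ a b, a < b → b < l → G.Adj (v a) (v b) := by
    intro a b hab hb
    by_cases h1 : b ≤ l - 2
    · exact F a b (by omega) h1 (by omega)
    · have : b = l - 1 := by omega
      subst this
      by_cases h2 : a = 1
      · subst h2
        exact L
      · exact B a (l-1) (by omega) (by omega) (by omega) (by omega) (by omega)
  intro a b ha hb hab
  rcases Nat.lt_or_gt_of_ne hab with h | h
  · exact W a b h hb
  · exact (W b a h ha).symm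

theorem aux_base {V : Type*} (G : SimpleGraph V) (v : V) (c : G.Walk v v)
    (hc : c.IsCycle) (hq : ¬ G.IsClique {x | x ∈ c.support})
    (hmin : ∀ (u : V) (c' : G.Walk u u), IsNonCliqueNonOddCycle G c' →
      c.length ≤ c'.length) :
    {y | y ∈ c.support ∧ G.Adj v y ∧ s(v, y) ∉ c.edges}.Subsingleton := by
  have h3 := hc.three_le_length
  have idx : ∀ y, y ∈ c.support → G.Adj v y → s(v, y) ∉ c.edges →
      ∃ i, 2 ≤ i ∧ i + 1 < c.length ∧ c.getVert i = y := by
    intro y hy ha he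
    obtain ⟨i, rfl, hi⟩ := SimpleGraph.Walk.mem_support_iff_exists_getVert.1 hy
    refine ⟨i, ?_, ?_, rfl⟩
    · by_contra h
      have : i = 0 ∨ i = 1 := by omega
      rcases this with rfl | rfl
      · simp at ha
      · apply he
        rw [SimpleGraph.Walk.mk_mem_edges_iff_exists]
        exact ⟨0, by omega, by simp⟩
    · by_contra h
      have : i = c.length ∨ i + 1 = c.length := by omega
      rcases this with rfl | h
      · simp at ha
      · apply he
        rw [SimpleGraph.Walk.mk_mem_edges_iff_exists]
        exact ⟨i, by omega, by simp [h]⟩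
  have main : ∀ i j, 2 ≤ i → i < j → j + 1 < c.length → G.Adj v (c.getVert i) →
      G.Adj v (c.getVert j) → False := by
    intro i j hi hij hj h0i h0j
    have K := aux_comb G c.length hmin c.getVert
      (fun a b ha hb h => hc.getVert_injOn' (by simp; omega) (by simp; omega) h)
      (fun k hk => c.adj_getVert_succ (by omega))
      (by
        have := c.adj_getVert_succ (i := c.length - 1) (by omega)
        rw [show c.length - 1 + 1 = c.length by omega] at this
        simpa using this)
      i j hi hij hj (by simpa using h0i) (by simpa using h0j)
    apply hq
    have R : ∀ x ∈ c.support, ∃ a < c.length, c.getVert a = x := by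
      intro x hx
      obtain ⟨a, rfl, ha⟩ := SimpleGraph.Walk.mem_support_iff_exists_getVert.1 hx
      rcases Nat.lt_or_ge a c.length with h | h
      · exact ⟨a, h, rfl⟩
      · have : a = c.length := by omega
        exact ⟨0, by omega, by simp [this]⟩
    intro x hx y hy hxy
    obtain ⟨a, ha, rfl⟩ := R x hx
    obtain ⟨b, hb, rfl⟩ := R y hy
    exact K a b ha hb (fun h => hxy (by rw [h]))
  rintro y ⟨hy, hay, hey⟩ z ⟨hz, haz, hez⟩
  obtain ⟨i, hi, hi2, rfl⟩ := idx y hy hay hey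
  obtain ⟨j, hj, hj2, rfl⟩ := idx z hz haz hez
  rcases Nat.lt_trichotomy i j with h | h | h
  · exact (main i j hi h hj2 hay haz).elim
  · rw [h]
  · exact (main j i hj h hi2 haz hay).elim

/-- If `c` is a shortest cycle of `G` whose vertex set induces neither a complete graph nor
an odd cycle, then every vertex of `c` is incident with at most one chord of `c`. -/
theorem at_most_one_chord_per_vertex {V : Type*} [Fintype V] (G : SimpleGraph V)
    (hconn : G.Connected) (hG : ¬ IsGallaiTree G) (v : V) (c : G.Walk v v)
    (hc : IsNonCliqueNonOddCycle G c)
    (hmin : ∀ (u : V) (c' : G.Walk u u), IsNonCliqueNonOddCycle G c' →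
      c.length ≤ c'.length) :
    ∀ x ∈ c.support,
      {y | y ∈ c.support ∧ G.Adj x y ∧ s(x, y) ∉ c.edges}.Subsingleton := by
  classical
  intro x hx
  have hs : ∀ y, y ∈ (c.rotate x hx).support ↔ y ∈ c.support := by
    intro y
    simp
  have he : ∀ e, e ∈ (c.rotate x hx).edges ↔ e ∈ c.edges := fun e =>
    (c.rotate_edges x hx).mem_iff
  have := aux_base G x (c.rotate x hx) ((SimpleGraph.Walk.isCycle_rotate hx).2 hc.1) (by simpa only [hs] using hc.2.1)
    (by simpa using hmin)
  simpa only [hs, he] using this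
end

section
/- Let G be a connected finite simple graph that is not a Gallai tree, and let C be a shortest cycle in G whose vertex set induces neither a complete graph nor an odd cycle. Then C has even length. -/
open SimpleGraph in
theorem aux_even_not_odd {V : Type*} {G : SimpleGraph V} {a b : V} (p : G.Walk a b)
    (hp : p.IsPath) (hodd : Odd p.length) : ¬ IsOddCycleSet G {x | x ∈ p.support} := by
  classical
  rintro ⟨n, hn, -, ⟨e⟩⟩
  have h1 : Nat.card {x // x ∈ p.support} = n := by
    have := Nat.card_congr e.toEquiv
    simpa using this
  have h2 : Nat.card {x // x ∈ p.support} = p.length + 1 := by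
    have : Nat.card {x // x ∈ p.support.toFinset} = p.support.toFinset.card := by
      rw [Nat.card_eq_fintype_card, Fintype.card_coe]
    rw [List.toFinset_card_of_nodup hp.support_nodup, Walk.length_support] at this
    simpa using this
  rw [h1] at h2
  subst h2
  grind

open SimpleGraph in
theorem aux_key_s4 {V : Type*} {G : SimpleGraph V} {N : ℕ}
    (H : ∀ (a b : V) (p : G.Walk a b), p.IsPath → G.Adj b a → 3 ≤ p.length → Odd p.length →
      p.length + 1 < N → G.IsClique {x | x ∈ p.support})
    {x y : V} (p : G.Walk x y) (q : G.Walk y x) (hp : p.IsPath) (hq : q.IsPath)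
    (hxy : G.Adj x y) (hp3 : 3 ≤ p.length) (hpo : Odd p.length) (hq2 : 2 ≤ q.length)
    (hqe : Even q.length) (hN : p.length + q.length = N)
    (hd : ∀ z, z ∈ p.support → z ∈ q.support → z = x ∨ z = y) :
    G.IsClique {z | z ∈ p.support ∨ z ∈ q.support} := by
  have hP := H _ _ p hp hxy.symm hp3 hpo (by omega)
  have hA : ∀ a ∈ p.support, a ≠ x → a ≠ y → G.IsClique {z | z = a ∨ z ∈ q.support} := by
    intro a ha hax hay
    have hay' : G.Adj a y := hP ha p.end_mem_support hay
    have hxa : G.Adj x a := hP p.start_mem_support ha hax.symm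
    have := H _ _ (Walk.cons hay' q)
      (by rw [Walk.cons_isPath_iff]; exact ⟨hq, fun h => by have := hd a ha h; tauto⟩) hxa
      (by simp; omega) (by simpa using hqe.add_one) (by simp; omega)
    simpa using this
  obtain ⟨a, ha, hax, hay⟩ : ∃ a ∈ p.support, a ≠ x ∧ a ≠ y := by
    refine ⟨p.getVert 1, p.getVert_mem_support 1, ?_, ?_⟩
    · rw [Ne, hp.getVert_eq_start_iff (by omega)]; omega
    · rw [Ne, hp.getVert_eq_end_iff (by omega)]; omega
  have hmix : ∀ z w, z ∈ p.support → w ∈ q.support → z ≠ w → G.Adj z w := by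
    intro z w hz hw hzw
    by_cases hzx : z = x
    · subst hzx
      exact hA a ha hax hay (Or.inr q.end_mem_support) (Or.inr hw) hzw
    by_cases hzy : z = y
    · subst hzy
      exact hA a ha hax hay (Or.inr q.start_mem_support) (Or.inr hw) hzw
    exact hA z hz hzx hzy (Or.inl rfl) (Or.inr hw) hzw
  rintro z (hz | hz) w (hw | hw) hzw
  · exact hP hz hw hzw
  · exact hmix z w hz hw hzw
  · exact (hmix w z hw hz hzw.symm).symm
  · exact hA a ha hax hay (Or.inr hz) (Or.inr hw) hzw

open SimpleGraph in
theorem aux_chordless {V : Type*} {G : SimpleGraph V} {v : V} (c : G.Walk v v)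
    (hc : c.IsCycle) (hodd : Odd c.length)
    (h : ∀ x ∈ c.support, ∀ y ∈ c.support, G.Adj x y → s(x, y) ∈ c.edges) :
    IsOddCycleSet G {x | x ∈ c.support} := by
  have h3 := hc.three_le_length
  refine ⟨c.length, hodd, h3, ⟨?_⟩⟩
  have hinj := hc.getVert_injOn'
  let f : Fin c.length → {x | x ∈ c.support} := fun i => ⟨c.getVert i, c.getVert_mem_support i⟩
  have hf : Function.Bijective f := by
    constructor
    · intro i j hij
      have : c.getVert i = c.getVert j := congrArg Subtype.val hij
      exact Fin.ext (hinj (by simp; omega) (by simp; omega) this)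
    · rintro ⟨x, hx⟩
      obtain ⟨n, hn, hnl⟩ := Walk.mem_support_iff_exists_getVert.1 hx
      rcases hnl.lt_or_eq with h | h
      · exact ⟨⟨n, h⟩, Subtype.ext hn⟩
      · refine ⟨⟨0, by omega⟩, Subtype.ext ?_⟩
        subst h
        simpa [f] using hn
  refine (RelIso.symm ⟨Equiv.ofBijective f hf, ?_⟩)
  intro i j
  change G.Adj (c.getVert i) (c.getVert j) ↔ _
  have hsub : ∀ i j : Fin c.length, (i - j).val = 1 ↔
      (i.val = j.val + 1 ∨ (i.val = 0 ∧ j.val + 1 = c.length)) := by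
    intro i j
    rw [Fin.sub_def]
    have hi := i.2
    have hj := j.2
    simp only
    rcases le_or_gt j.val i.val with hji | hji
    · rw [show c.length - j.val + i.val = (i.val - j.val) + c.length by omega,
        Nat.add_mod_right, Nat.mod_eq_of_lt (by omega)]
      omega
    · rw [Nat.mod_eq_of_lt (by omega)]
      omega
  rw [cycleGraph_adj', hsub, hsub]
  have key : ∀ k < c.length, ∀ l : Fin c.length, c.getVert (k+1) = c.getVert l ↔
      (l.val = k + 1 ∨ (l.val = 0 ∧ k + 1 = c.length)) := by
    intro k hk l
    have hl := l.2
    rcases (show k + 1 ≤ c.length from hk).lt_or_eq with h | h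
    · rw [hinj.eq_iff (by simp; omega) (by simp; omega)]
      omega
    · have h0 : c.getVert (k + 1) = c.getVert 0 := by
        rw [h, Walk.getVert_length, Walk.getVert_zero]
      rw [h0, hinj.eq_iff (by simp) (by simp; omega)]
      omega
  constructor
  · intro hij
    have := h _ (c.getVert_mem_support i) _ (c.getVert_mem_support j) hij
    rw [Walk.mk_mem_edges_iff_exists] at this
    obtain ⟨k, hk, hkk⟩ := this
    have hk0 : ∀ l : Fin c.length, c.getVert k = c.getVert l ↔ k = l.val := fun l =>
      hinj.eq_iff (by simp; omega) (by simp; omega)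
    have e1 := key k hk i
    have e2 := key k hk j
    have e3 := hk0 i
    have e4 := hk0 j
    rw [Sym2.eq_iff, e1, e2, e3, e4] at hkk
    omega
  · rintro (h | h)
    · have := c.adj_getVert_succ j.2
      rw [(key j j.2 i).2 h] at this
      exact this.symm
    · have := c.adj_getVert_succ i.2
      rwa [(key i i.2 j).2 h] at this

/-- A shortest cycle of `G` whose vertex set induces neither a complete graph nor an odd
cycle has even length. -/
theorem shortest_cycle_even {V : Type*} [Fintype V] (G : SimpleGraph V)
    (hconn : G.Connected) (hG : ¬ IsGallaiTree G) (v : V) (c : G.Walk v v)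
    (hc : IsNonCliqueNonOddCycle G c)
    (hmin : ∀ (u : V) (c' : G.Walk u u), IsNonCliqueNonOddCycle G c' →
      c.length ≤ c'.length) :
    Even c.length := by
  classical
  by_contra hne
  rw [Nat.not_even_iff_odd] at hne
  obtain ⟨hcyc, hncl, hno⟩ := hc
  have H : ∀ (a b : V) (p : G.Walk a b), p.IsPath → G.Adj b a → 3 ≤ p.length → Odd p.length →
      p.length + 1 < c.length → G.IsClique {x | x ∈ p.support} := by
    intro a b p hp hba h3 ho hlt
    by_contra hcl
    have hs : {x | x ∈ (SimpleGraph.Walk.cons hba p).support} = {x | x ∈ p.support} := by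
      ext z
      simp only [SimpleGraph.Walk.support_cons, List.mem_cons, Set.mem_setOf_eq]
      constructor
      · rintro (rfl | h)
        · exact p.end_mem_support
        · exact h
      · exact Or.inr
    have := hmin b (SimpleGraph.Walk.cons hba p) ⟨?_, ?_, ?_⟩
    · simp at this; omega
    · rw [SimpleGraph.Walk.isCycle_iff_isPath_tail_and_le_length]
      constructor
      · simpa using hp
      · simp; omega
    · rwa [hs]
    · rw [hs]; exact aux_even_not_odd p hp ho
  by_cases hch : ∀ x ∈ c.support, ∀ y ∈ c.support, G.Adj x y → s(x, y) ∈ c.edges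
  · exact hno (aux_chordless c hcyc hne hch)
  push Not at hch
  obtain ⟨x, hx, y, hy, hxy, hed⟩ := hch
  obtain ⟨p, q, hpq⟩ : ∃ (p : G.Walk x y) (q : G.Walk y x), p.append q = c.rotate x hx := by
    have hy' : y ∈ (c.rotate x hx).support := by simpa using hy
    exact ⟨_, _, (c.rotate x hx).take_spec hy'⟩
  have hcyc' : (p.append q).IsCycle := hpq ▸ hcyc.rotate hx
  have hlen : p.length + q.length = c.length := by
    rw [← SimpleGraph.Walk.length_append, hpq, SimpleGraph.Walk.length_rotate]
  have hed' : s(x, y) ∉ (p.append q).edges := by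
    rw [hpq, (c.rotate_edges x hx).perm.mem_iff]; exact hed
  have hsup : ∀ z, z ∈ c.support ↔ z ∈ p.support ∨ z ∈ q.support := by
    intro z
    rw [← SimpleGraph.Walk.mem_support_append_iff, hpq, SimpleGraph.Walk.mem_support_rotate_iff]
  have len2 : ∀ {a b : V} (r : G.Walk a b), a ≠ b → s(a, b) ∉ r.edges → 2 ≤ r.length := by
    intro a b r hab hr
    cases r with
    | nil => exact absurd rfl hab
    | cons h r =>
      cases r with
      | nil => simp at hr
      | cons h' r => simp
  rw [SimpleGraph.Walk.edges_append, List.mem_append, not_or] at hed'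
  have hp2 := len2 p hxy.ne hed'.1
  have hq2 := len2 q hxy.ne.symm (by rw [Sym2.eq_swap]; exact hed'.2)
  have hpp : p.IsPath := hcyc'.isPath_of_append_left (by
    rw [SimpleGraph.Walk.nil_iff_length_eq]; omega)
  have hqp : q.IsPath := hcyc'.isPath_of_append_right (by
    rw [SimpleGraph.Walk.nil_iff_length_eq]; omega)
  have hd : ∀ z, z ∈ p.support → z ∈ q.support → z = x ∨ z = y := by
    intro z hz1 hz2
    have hnd := hcyc'.support_nodup
    rw [SimpleGraph.Walk.tail_support_append, List.nodup_append] at hnd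
    rw [SimpleGraph.Walk.mem_support_iff] at hz1 hz2
    rcases hz1 with h1 | h1
    · exact Or.inl h1
    rcases hz2 with h2 | h2
    · exact Or.inr h2
    exact absurd rfl (hnd.2.2 z h1 z h2)
  apply hncl
  rw [← hlen] at hne
  rcases Nat.even_or_odd p.length with he | ho
  · have hqo : Odd q.length := by grind
    have := aux_key_s4 H q p hqp hpp hxy.symm (by grind) hqo hp2 he (by omega)
      (fun z h1 h2 => (hd z h2 h1).symm)
    refine this.subset ?_
    intro z hz
    exact ((hsup z).1 hz).symm
  · have hqe : Even q.length := by grind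
    have := aux_key_s4 H p q hpp hqp hxy (by grind) ho hq2 hqe (by omega) hd
    refine this.subset ?_
    intro z hz
    exact (hsup z).1 hz
end

section
/- Let G be a connected finite simple graph that is not a Gallai tree, and let C be a shortest cycle in G whose vertex set induces neither a complete graph nor an odd cycle. Then C has at most one chord. -/
/-- Path segment from `x` to `y` through the list `A`, with edges in `E`. -/
def Seg {V : Type*} (E : Set (Sym2 V)) (x : V) (A : List V) (y : V) : Prop :=
  List.IsChain (fun a b => s(a, b) ∈ E) (x :: (A ++ [y]))

/-- A list is a cycle with edges in `E`. -/
def CycL {V : Type*} (E : Set (Sym2 V)) (l : List V) : Prop :=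
  l.Nodup ∧ 3 ≤ l.length ∧ Cycle.Chain (fun a b => s(a, b) ∈ E) (l : Cycle V)

/-- Clique, or odd with no vertex with three neighbours. -/
def GoodL {V : Type*} (G : SimpleGraph V) (l : List V) : Prop :=
  G.IsClique {z | z ∈ l} ∨ (Odd l.length ∧ ∀ v ∈ l, ∀ a ∈ l, ∀ b ∈ l, ∀ c ∈ l,
    G.Adj v a → G.Adj v b → G.Adj v c → a = b ∨ a = c ∨ b = c)

section aux
variable {V : Type*} {G : SimpleGraph V} {E F : Set (Sym2 V)}

theorem seg_split {x y z : V} {A B : List V} :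
    Seg E x (A ++ y :: B) z ↔ Seg E x A y ∧ Seg E y B z := by
  unfold Seg
  rw [List.append_assoc, List.cons_append, List.isChain_cons_split]

theorem seg_nil {x y : V} : Seg E x [] y ↔ s(x, y) ∈ E := by
  simp [Seg]

theorem seg_cons {x y z : V} {B : List V} :
    Seg E x (y :: B) z ↔ s(x, y) ∈ E ∧ Seg E y B z := by
  rw [← seg_nil]; exact seg_split (A := [])

theorem seg_mono (h : E ⊆ F) {x y : V} {A : List V} (hs : Seg E x A y) : Seg F x A y :=
  List.IsChain.imp (fun _ _ hab => h hab) hs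

theorem seg_rev {x y : V} {A : List V} (hs : Seg E x A y) : Seg E y A.reverse x := by
  unfold Seg at *
  have : (y :: (A.reverse ++ [x])) = (x :: (A ++ [y])).reverse := by simp
  rw [this, List.isChain_reverse]
  refine List.IsChain.imp (fun a b hab => ?_) hs
  rwa [Sym2.eq_swap]

theorem cyc_cons {x : V} {A : List V} :
    CycL E (x :: A) ↔ (x :: A).Nodup ∧ 2 ≤ A.length ∧ Seg E x A x := by
  unfold CycL Seg
  rw [Cycle.chain_coe_cons]
  simp

theorem cyc_rot {l m : List V} (h : l ~r m) (hl : CycL E l) : CycL E m := by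
  refine ⟨h.nodup_iff.1 hl.1, h.perm.length_eq ▸ hl.2.1, ?_⟩
  rw [← Cycle.coe_eq_coe.2 h]; exact hl.2.2

theorem good_perm {l m : List V} (h : l.Perm m) (hl : GoodL G l) : GoodL G m := by
  unfold GoodL at *
  simpa only [h.mem_iff, h.length_eq] using hl

theorem seg_last {x y : V} {A : List V} (hs : Seg E x A y) (hA : A ≠ []) :
    ∃ A' z, A = A' ++ [z] ∧ s(z, y) ∈ E := by
  obtain ⟨A', z, rfl⟩ := List.eq_nil_or_concat A |>.resolve_left hA
  exact ⟨A', z, by simp, seg_nil.1 (seg_split.1 (by simpa using hs)).2⟩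

/-- A chord of a good cycle forces a clique. -/
theorem three {x y : V} {A B : List V} (hc : CycL G.edgeSet (x :: A ++ y :: B))
    (hA : A ≠ []) (hB : B ≠ []) (h : G.Adj x y) (hg : GoodL G (x :: A ++ y :: B)) :
    G.IsClique {z | z ∈ x :: A ++ y :: B} := by
  rcases hg with hg | hg
  · exact hg
  exfalso
  rw [List.cons_append, cyc_cons, seg_split] at hc
  obtain ⟨hn, -, h1, h2⟩ := hc
  obtain ⟨a, A, rfl⟩ := List.exists_cons_of_ne_nil hA
  obtain ⟨B, b, rfl, hb⟩ := seg_last h2 hB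
  have ha := (seg_cons.1 h1).1
  rw [SimpleGraph.mem_edgeSet] at ha hb
  have := hg.2 x (by simp) a (by simp) y (by simp) b (by simp) ha h hb.symm
  simp at hn
  grind

theorem cyc_split {x y : V} {A B : List V} : CycL E (x :: A ++ y :: B) ↔
    (x :: A ++ y :: B).Nodup ∧ 1 ≤ A.length + B.length ∧ Seg E x A y ∧ Seg E y B x := by
  rw [List.cons_append, cyc_cons, seg_split]
  simp only [List.length_append, List.length_cons]
  constructor <;> rintro ⟨a, b, c⟩ <;> refine ⟨a, by omega, c⟩

/-- Cutting along a chord. -/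
theorem cyc_cut {x y : V} {A B : List V} (hc : CycL E (x :: A ++ y :: B)) (hEF : E ⊆ F)
    (hA : A ≠ []) (h : s(x, y) ∈ F) : CycL F (x :: A ++ [y]) := by
  rw [cyc_split] at *
  obtain ⟨hn, -, h1, h2⟩ := hc
  refine ⟨?_, ?_, seg_mono hEF h1, ?_⟩
  · refine hn.sublist ?_
    simp
  · have := List.length_pos_of_ne_nil hA; simp; omega
  · rw [seg_nil, Sym2.eq_swap]; exact h

theorem rot2 {x y : V} {A B : List V} : (x :: A ++ y :: B) ~r (y :: B ++ x :: A) :=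
  List.isRotated_append

/-- A large clique side gives a clique. -/
theorem clique_side {n : ℕ} (H : ∀ l, CycL G.edgeSet l → l.length < n → GoodL G l)
    {x y : V} {A B : List V} (hc : CycL G.edgeSet (x :: A ++ y :: B))
    (hn : (x :: A ++ y :: B).length = n)
    (hA : 2 ≤ A.length) (hB : B ≠ []) (h : G.Adj x y)
    (hq : G.IsClique {z | z ∈ x :: A ++ [y]}) :
    G.IsClique {z | z ∈ x :: A ++ y :: B} := by
  have key : ∀ a ∈ A, G.IsClique {z | z ∈ x :: [a] ++ y :: B} := by
    intro a ha
    have hnd := (cyc_split.1 hc).1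
    have hxa : G.Adj x a := hq (by simp) (by simp [ha]) (by simp at hnd; grind)
    have hay : G.Adj a y := hq (by simp [ha]) (by simp) (by simp at hnd; grind)
    have hc' : CycL G.edgeSet (x :: [a] ++ y :: B) := by
      rw [cyc_split] at *
      obtain ⟨hn, -, h1, h2⟩ := hc
      refine ⟨?_, by simp, ?_, h2⟩
      · refine hn.sublist ?_
        simpa using (List.singleton_sublist.2 ha).append (List.Sublist.refl (y :: B))
      · rw [seg_cons, seg_nil]; exact ⟨hxa, hay⟩
    refine three hc' (by simp) hB h (H _ hc' ?_)
    simp at hn ⊢; omega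
  obtain ⟨a0, ha0⟩ := List.exists_mem_of_length_pos (by omega : 0 < A.length)
  intro u hu w hw huw
  simp only [Set.mem_ofPred_eq, List.cons_append, List.mem_cons, List.mem_append] at hu hw
  by_cases h1 : u ∈ A
  · by_cases h2 : w ∈ A
    · exact hq (by simp [h1]) (by simp [h2]) huw
    · exact key u h1 (by simp) (by simp; tauto) huw
  · by_cases h2 : w ∈ A
    · exact key w h2 (by simp; tauto) (by simp) huw
    · exact key a0 ha0 (by simp; tauto) (by simp; tauto) huw

theorem odd_side {n : ℕ} (H : ∀ l, CycL G.edgeSet l → l.length < n → GoodL G l)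
    {x y : V} {A B : List V} (hc : CycL G.edgeSet (x :: A ++ y :: B))
    (hn : (x :: A ++ y :: B).length = n)
    (hA : A ≠ []) (hB : B ≠ []) (h : G.Adj x y)
    (hq : ¬ G.IsClique {z | z ∈ x :: A ++ y :: B}) : Odd A.length := by
  have h1 : CycL G.edgeSet (x :: A ++ [y]) := cyc_cut hc le_rfl hA h
  have hA' := List.length_pos_of_ne_nil hA
  have hB' := List.length_pos_of_ne_nil hB
  rcases H _ h1 (by simp at hn ⊢; omega) with h2 | h2
  · by_cases h3 : 2 ≤ A.length
    · exact absurd (clique_side H hc hn h3 hB h h2) hq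
    · have : A.length = 1 := by omega
      rw [this]; decide
  · have := h2.1
    simp at this
    grind

theorem chord_side {n : ℕ} (H : ∀ l, CycL G.edgeSet l → l.length < n → GoodL G l)
    {x y a b : V} {A B A' B' : List V} (hc : CycL G.edgeSet (x :: A ++ y :: B))
    (hn : (x :: A ++ y :: B).length = n)
    (hA : A ≠ []) (hB : B ≠ []) (h : G.Adj x y)
    (hr : (x :: A ++ [y]) ~r (a :: A' ++ b :: B')) (hA' : A' ≠ []) (hB' : B' ≠ [])
    (hab : G.Adj a b) : G.IsClique {z | z ∈ x :: A ++ y :: B} := by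
  have h1 : CycL G.edgeSet (x :: A ++ [y]) := cyc_cut hc le_rfl hA h
  have hB2 := List.length_pos_of_ne_nil hB
  have l1 := List.length_pos_of_ne_nil hA'
  have l2 := List.length_pos_of_ne_nil hB'
  have hg := H _ h1 (by simp at hn ⊢; omega)
  have := three (cyc_rot hr h1) hA' hB' hab (good_perm hr.perm hg)
  have hl := hr.perm.length_eq
  refine clique_side H hc hn ?_ hB h ?_
  · simp at hl; omega
  · simpa only [hr.perm.mem_iff] using this

theorem cross {n : ℕ} (H : ∀ l, CycL G.edgeSet l → l.length < n → GoodL G l)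
    {x a y b : V} {P Q R S : List V}
    (hc : CycL G.edgeSet (x :: (P ++ a :: Q) ++ y :: (R ++ b :: S)))
    (hn : (x :: (P ++ a :: Q) ++ y :: (R ++ b :: S)).length = n)
    (hxy : G.Adj x y) (hab : G.Adj a b)
    (hq : ¬ G.IsClique {z | z ∈ x :: (P ++ a :: Q) ++ y :: (R ++ b :: S)}) : S = [] := by
  by_contra hS
  have hS' := List.length_pos_of_ne_nil hS
  have o1 := odd_side H hc hn (by simp) (by simp) hxy hq
  have hr2 := rot2 (x := x) (y := y) (A := P ++ a :: Q) (B := R ++ b :: S)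
  have hc2 := cyc_rot hr2 hc
  have hn2 := hr2.perm.length_eq.symm.trans hn
  have hq2 : ¬ G.IsClique {z | z ∈ y :: (R ++ b :: S) ++ x :: (P ++ a :: Q)} := by
    simpa only [hr2.perm.mem_iff] using hq
  have hr3 : (x :: (P ++ a :: Q) ++ y :: (R ++ b :: S)) ~r
      (a :: (Q ++ y :: R) ++ b :: (S ++ x :: P)) := by
    have := List.isRotated_append (l := x :: P) (l' := a :: Q ++ y :: (R ++ b :: S))
    simpa using this
  have hc3 := cyc_rot hr3 hc
  have hn3 := hr3.perm.length_eq.symm.trans hn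
  have hq3 : ¬ G.IsClique {z | z ∈ a :: (Q ++ y :: R) ++ b :: (S ++ x :: P)} := by
    simpa only [hr3.perm.mem_iff] using hq
  have o2 := odd_side H hc2 hn2 (by simp) (by simp) hxy.symm hq2
  have o3 := odd_side H hc3 hn3 (by simp) (by simp) hab hq3
  have hcc : CycL G.edgeSet (x :: P ++ a :: (b :: R.reverse ++ [y])) := by
    rw [cyc_split] at *
    obtain ⟨hnd, -, h1, h2⟩ := hc
    rw [seg_split] at h1 h2
    refine ⟨?_, by simp; omega, h1.1, ?_⟩
    · have hs : (x :: P ++ a :: (y :: (R ++ [b]))).Sublist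
          (x :: (P ++ a :: Q) ++ y :: (R ++ b :: S)) := by
        simp
      have hp : (x :: P ++ a :: (b :: R.reverse ++ [y])).Perm
          (x :: P ++ a :: (y :: (R ++ [b]))) := by
        refine List.Perm.append_left _ (List.Perm.cons _ ?_)
        have := List.reverse_perm (y :: (R ++ [b]))
        simpa using this
      exact hp.nodup_iff.2 (hnd.sublist hs)
    · rw [List.cons_append, seg_cons, seg_split, seg_nil]
      exact ⟨hab, seg_rev h2.1, hxy.symm⟩
  have hcl : G.IsClique {z | z ∈ x :: P ++ a :: (b :: R.reverse ++ [y])} := by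
    rcases H _ hcc (by simp at hn ⊢; omega) with h | h
    · exact h
    · exfalso
      have := h.1
      simp at this o1 o2 o3
      grind
  have hxb : G.Adj x b := hcl (by simp) (by simp) (by have := hc.1; simp at this; grind)
  refine hq2 (chord_side H hc2 hn2 (by simp) (by simp) hxy.symm (a := x) (b := b)
    (A' := y :: R) (B' := S) ?_ (by simp) hS hxb)
  have := List.isRotated_append (l := y :: (R ++ b :: S)) (l' := [x])
  simpa using this

theorem cross_false {n : ℕ} (H : ∀ l, CycL G.edgeSet l → l.length < n → GoodL G l)
    {x a y b : V} {P Q R S : List V}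
    (hc : CycL G.edgeSet (x :: (P ++ a :: Q) ++ y :: (R ++ b :: S)))
    (hn : (x :: (P ++ a :: Q) ++ y :: (R ++ b :: S)).length = n)
    (hxy : G.Adj x y) (hab : G.Adj a b) :
    G.IsClique {z | z ∈ x :: (P ++ a :: Q) ++ y :: (R ++ b :: S)} := by
  by_contra hq
  have rot : ∀ {x a y b : V} {P Q R S : List V}, (x :: (P ++ a :: Q) ++ y :: (R ++ b :: S)) ~r
      (a :: (Q ++ y :: R) ++ b :: (S ++ x :: P)) := by
    intro x a y b P Q R S
    have := List.isRotated_append (l := x :: P) (l' := a :: Q ++ y :: (R ++ b :: S))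
    simpa using this
  have step : ∀ {l m : List V}, l ~r m → CycL G.edgeSet l ∧ l.length = n ∧
      ¬ G.IsClique {z | z ∈ l} → CycL G.edgeSet m ∧ m.length = n ∧
      ¬ G.IsClique {z | z ∈ m} := by
    intro l m h ⟨h1, h2, h3⟩
    exact ⟨cyc_rot h h1, h.perm.length_eq ▸ h2, by simpa only [h.perm.mem_iff] using h3⟩
  have a0 := And.intro hc (And.intro hn hq)
  have a1 := step rot a0
  have a2 := step rot a1
  have a3 := step rot a2
  have s0 := cross H a0.1 a0.2.1 hxy hab a0.2.2
  have s1 := cross H a1.1 a1.2.1 hab hxy.symm a1.2.2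
  have s2 := cross H a2.1 a2.2.1 hxy.symm hab.symm a2.2.2
  have s3 := cross H a3.1 a3.2.1 hab.symm hxy a3.2.2
  subst s0 s1 s2 s3
  apply hq
  have := (cyc_split.1 hc).2.2
  simp only [List.nil_append, seg_cons, seg_nil, SimpleGraph.mem_edgeSet] at this
  obtain ⟨⟨h1, h2⟩, h3, h4⟩ := this
  intro u hu w hw huw
  simp at hu hw
  have := h1.symm
  have := h2.symm
  have := h3.symm
  have := h4.symm
  have := hxy.symm
  have := hab.symm
  rcases hu with rfl | rfl | rfl | rfl <;> rcases hw with rfl | rfl | rfl | rfl <;>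
    first | assumption | exact absurd rfl huw

/-- Extraction of a chord. -/
theorem extract {l : List V} (hl : CycL E l) {a b : V} (ha : a ∈ l) (hb : b ∈ l) (hab : a ≠ b)
    (he : s(a, b) ∉ E) : ∃ A B, l ~r (a :: A ++ b :: B) ∧ A ≠ [] ∧ B ≠ [] := by
  obtain ⟨l1, l2, rfl⟩ := List.append_of_mem ha
  have hr : (l1 ++ a :: l2) ~r (a :: (l2 ++ l1)) := by
    simpa using List.isRotated_append (l := l1) (l' := a :: l2)
  have hb' : b ∈ l2 ++ l1 := by
    have := hr.perm.mem_iff.1 hb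
    simpa [hab.symm] using this
  obtain ⟨A, B, h⟩ := List.append_of_mem hb'
  rw [h] at hr
  have h2 := (cyc_split.1 (cyc_rot hr hl)).2.2
  refine ⟨A, B, hr, ?_, ?_⟩
  · rintro rfl
    exact he (seg_nil.1 h2.1)
  · rintro rfl
    exact he (Sym2.eq_swap ▸ seg_nil.1 h2.2)

theorem main_list {n : ℕ} (H : ∀ l, CycL G.edgeSet l → l.length < n → GoodL G l)
    {l : List V} (hE : E ⊆ G.edgeSet) (hl : CycL E l) (hn : l.length = n)
    (hq : ¬ G.IsClique {z | z ∈ l}) {x y a b : V}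
    (hx : x ∈ l) (hy : y ∈ l) (ha : a ∈ l) (hb : b ∈ l) (hxy : G.Adj x y) (hab : G.Adj a b)
    (h1 : s(x, y) ∉ E) (h2 : s(a, b) ∉ E) : s(x, y) = s(a, b) := by
  by_contra hne
  have side : ∀ {x y : V} {A B : List V}, CycL E (x :: A ++ y :: B) →
      (x :: A ++ y :: B).length = n → A ≠ [] → B ≠ [] → G.Adj x y → s(x, y) ≠ s(a, b) →
      a ∈ x :: A ++ [y] → b ∈ x :: A ++ [y] → G.IsClique {z | z ∈ x :: A ++ y :: B} := by
    intro x y A B hc hn hA hB hxy hne ha hb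
    have hc' : CycL (insert s(x, y) E) (x :: A ++ [y]) :=
      cyc_cut hc (Set.subset_insert _ _) hA (Set.mem_insert _ _)
    obtain ⟨A', B', hr, hA', hB'⟩ := extract hc' ha hb hab.ne (by
      rintro (h | h)
      · exact hne h.symm
      · exact h2 h)
    exact chord_side H ⟨hc.1, hc.2.1, hc.2.2.imp fun _ _ h => hE h⟩ hn hA hB hxy hr hA' hB' hab
  obtain ⟨A, B, hr, hA, hB⟩ := extract hl hx hy hxy.ne h1
  have hc := cyc_rot hr hl
  have hcG : CycL G.edgeSet (x :: A ++ y :: B) := ⟨hc.1, hc.2.1, hc.2.2.imp fun _ _ h => hE h⟩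
  have hn' := hr.perm.length_eq.symm.trans hn
  rw [hr.perm.mem_iff] at ha hb
  simp only [hr.perm.mem_iff] at hq
  have hr2 := rot2 (x := x) (y := y) (A := A) (B := B)
  have hcross : ∀ a ∈ A, ∀ b ∈ B, G.Adj a b → False := by
    clear ha hb
    intro a ha b hb hab
    obtain ⟨P, Q, rfl⟩ := List.append_of_mem ha
    obtain ⟨R, S, rfl⟩ := List.append_of_mem hb
    exact hq (cross_false H hcG hn' hxy hab)
  by_cases c1 : a ∈ x :: A ++ [y] ∧ b ∈ x :: A ++ [y]
  · exact hq (side hc hn' hA hB hxy hne c1.1 c1.2)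
  by_cases c2 : a ∈ y :: B ++ [x] ∧ b ∈ y :: B ++ [x]
  · have := side (cyc_rot hr2 hc) (hr2.perm.length_eq.symm.trans hn') hB hA hxy.symm
      (by rwa [Sym2.eq_swap]) c2.1 c2.2
    simp only [← hr2.perm.mem_iff] at this
    exact hq this
  have := hcross a
  have := hcross b
  have := hab.symm
  simp at ha hb c1 c2
  grind

theorem walk_chain {u v : V} (p : G.Walk u v) (hp : ∀ e ∈ p.edges, e ∈ E) :
    List.IsChain (fun a b => s(a, b) ∈ E) p.support := by
  induction p with
  | nil => simp
  | cons h p ih =>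
    simp only [SimpleGraph.Walk.edges_cons, List.mem_cons, forall_eq_or_imp] at hp
    have := ih hp.2
    rw [SimpleGraph.Walk.support_cons]
    cases p with
    | nil => simpa using hp.1
    | cons h' p => 
      rw [SimpleGraph.Walk.support_cons] at *
      exact List.IsChain.cons_cons hp.1 this

theorem walk_cyc {v : V} (c : G.Walk v v) (hc : c.IsCycle) :
    ∃ l : List V, CycL {e | e ∈ c.edges} l ∧ l.length = c.length ∧ ∀ z, z ∈ l ↔ z ∈ c.support := by
  have h3 := hc.three_le_length
  have hch := walk_chain (E := {e | e ∈ c.edges}) c (fun _ h => h)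
  have hnd := hc.nodup_dropLast_support
  have hlen := c.length_support
  have h1 : c.support = v :: c.support.tail := by simp
  have h2 : c.support.tail ≠ [] := by
    intro h; have := congrArg List.length h; rw [List.length_tail, List.length_nil] at this; omega
  obtain ⟨T, w, hT⟩ := List.eq_nil_or_concat c.support.tail |>.resolve_left h2
  have hs : c.support = v :: (T ++ [w]) := by rw [h1, hT, List.concat_eq_append]
  have hw : w = v := by
    have := c.getLast_support
    simp only [hs] at this
    simpa using this
  subst hw
  refine ⟨w :: T, ?_, ?_, ?_⟩
  · rw [cyc_cons]
    rw [hs] at hnd hch hlen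
    refine ⟨?_, ?_, hch⟩
    · rwa [← List.cons_append, List.dropLast_concat] at hnd
    · simp at hlen; omega
  · rw [hs] at hlen; simp at hlen ⊢; omega
  · intro z; rw [hs]; simp; tauto

theorem cyc_walk {l : List V} (hl : CycL G.edgeSet l) :
    ∃ (u : V) (c : G.Walk u u), c.IsCycle ∧ c.length = l.length ∧ ∀ z, z ∈ c.support ↔ z ∈ l := by
  cases l with
  | nil => have := hl.2.1; simp at this
  | cons x A =>
    rw [cyc_cons] at hl
    obtain ⟨hnd, hlen, hs⟩ := hl
    have hs' : List.IsChain G.Adj (x :: (A ++ [x])) := hs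
    obtain ⟨a, b, c, hc, hcl⟩ : ∃ (a b : V) (c : G.Walk a b), c.support = x :: (A ++ [x]) ∧
        c.length = (x :: (A ++ [x])).length - 1 :=
      ⟨_, _, SimpleGraph.Walk.ofSupport (x :: (A ++ [x])) (List.cons_ne_nil _ _) hs',
        SimpleGraph.Walk.support_ofSupport _ _, SimpleGraph.Walk.length_ofSupport _ _⟩
    replace hcl : c.length = A.length + 1 := by simpa using hcl
    have ha : a = x := by
      have := c.head_support
      simp only [hc] at this
      simpa using this.symm
    have hb : b = x := by
      have := c.getLast_support
      simp only [hc] at this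
      simpa using this.symm
    subst ha
    subst hb
    refine ⟨_, c, ?_, by simpa using hcl, by intro z; rw [hc]; simp; tauto⟩
    rw [SimpleGraph.Walk.isCycle_iff_isPath_tail_and_le_length]
    refine ⟨?_, by omega⟩
    rw [SimpleGraph.Walk.isPath_def, SimpleGraph.Walk.support_tail_of_not_nil, hc]
    · simp at hnd ⊢
      grind
    · rw [SimpleGraph.Walk.not_nil_iff_lt_length]; omega

theorem good_of_odd {l : List V} (hnd : l.Nodup) (h : IsOddCycleSet G {z | z ∈ l}) : GoodL G l := by
  right
  obtain ⟨n, hn, h3, ⟨φ⟩⟩ := h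
  have hcard : l.length = n := by
    classical
    have h1 := Nat.card_congr φ.toEquiv
    rw [Nat.card_eq_fintype_card (α := Fin n), Fintype.card_fin] at h1
    rw [← h1, ← List.toFinset_card_of_nodup hnd]
    have : {z | z ∈ l} = (l.toFinset : Set V) := by ext; simp
    rw [this, Nat.card_coe_set_eq, Set.ncard_coe_finset]
  refine ⟨hcard ▸ hn, ?_⟩
  intro v hv a ha b hb c hc h1 h2 h4
  obtain ⟨m, rfl⟩ : ∃ m, n = m + 3 := ⟨n - 3, by omega⟩
  have e1 : (SimpleGraph.cycleGraph (m+3)).Adj (φ ⟨v, hv⟩) (φ ⟨a, ha⟩) := φ.map_rel_iff.2 h1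
  have e2 : (SimpleGraph.cycleGraph (m+3)).Adj (φ ⟨v, hv⟩) (φ ⟨b, hb⟩) := φ.map_rel_iff.2 h2
  have e3 : (SimpleGraph.cycleGraph (m+3)).Adj (φ ⟨v, hv⟩) (φ ⟨c, hc⟩) := φ.map_rel_iff.2 h4
  have key : ∀ {p q r s : Fin (m+3)}, (SimpleGraph.cycleGraph (m+3)).Adj p q →
      (SimpleGraph.cycleGraph (m+3)).Adj p r → (SimpleGraph.cycleGraph (m+3)).Adj p s →
      q = r ∨ q = s ∨ r = s := by
    intro p q r s h1 h2 h3
    rw [← SimpleGraph.mem_neighborSet, SimpleGraph.cycleGraph_neighborSet] at h1 h2 h3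
    simp at h1 h2 h3
    grind
  rcases key e1 e2 e3 with h | h | h
  · left; simpa using φ.injective h
  · right; left; simpa using φ.injective h
  · right; right; simpa using φ.injective h

end aux

/-- A shortest cycle of `G` whose vertex set induces neither a complete graph nor an odd
cycle has at most one chord. -/
theorem shortest_cycle_at_most_one_chord {V : Type*} [Fintype V] (G : SimpleGraph V)
    (hconn : G.Connected) (hG : ¬ IsGallaiTree G) (v : V) (c : G.Walk v v)
    (hc : IsNonCliqueNonOddCycle G c)
    (hmin : ∀ (u : V) (c' : G.Walk u u), IsNonCliqueNonOddCycle G c' →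
      c.length ≤ c'.length) :
    (chordSet G c).Subsingleton := by
  have H : ∀ l, CycL G.edgeSet l → l.length < c.length → GoodL G l := by
    intro l hl hlen
    by_contra hg
    obtain ⟨u, c', h1, h2, h3⟩ := cyc_walk hl
    have := hmin u c' ⟨h1, ?_, ?_⟩
    · omega
    · simp only [h3]; exact fun h => hg (Or.inl h)
    · simp only [h3]; exact fun h => hg (good_of_odd hl.1 h)
  obtain ⟨l, hl, hlen, hmem⟩ := walk_cyc c hc.1
  have hq : ¬ G.IsClique {z | z ∈ l} := by
    simp only [hmem]; exact hc.2.1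
  rintro ⟨x, y⟩ ⟨h1, h2, h3⟩ ⟨a, b⟩ ⟨h4, h5, h6⟩
  exact main_list H (fun e he => c.edges_subset_edgeSet he) hl hlen hq
    ((hmem x).2 (h2 x (Sym2.mem_mk_left x y))) ((hmem y).2 (h2 y (Sym2.mem_mk_right x y)))
    ((hmem a).2 (h5 a (Sym2.mem_mk_left a b))) ((hmem b).2 (h5 b (Sym2.mem_mk_right a b)))
    h1 h4 h3 h6
end

section
/- Let G be a connected finite simple graph that is not a Gallai tree. Then G admits an orientation D of its edges such that every vertex has at least one out-going edge (equivalently, the in-degree of every vertex v in D is at most deg(v) − 1), and the number of even Eulerian subgraphs of D differs from the number of odd Eulerian subgraphs of D. -/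
/-- `D` is an orientation of `G`: every directed edge of `D` is an edge of `G`, and every
edge of `G` receives exactly one of its two possible directions. -/
def IsOrientation {V : Type*} (G : SimpleGraph V) (D : V → V → Bool) : Prop :=
  (∀ u w, D u w = true → G.Adj u w) ∧ (∀ u w, G.Adj u w → D u w ≠ D w u)

/-- `F` is an Eulerian subgraph of the orientation `D`: a set of directed edges of `D`
in which every vertex has equal in-degree and out-degree. -/
def IsEulerianSubgraph {V : Type*} [Fintype V] [DecidableEq V] (D : V → V → Bool)
    (F : Finset (V × V)) : Prop :=
  (∀ p ∈ F, D p.1 p.2 = true) ∧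
    ∀ v : V, (F.filter (fun p => p.2 = v)).card = (F.filter (fun p => p.1 = v)).card

open Classical in
/-- Good sets: the induced subgraph on `S` has a good orientation. -/
def PP {V : Type*} [Fintype V] [DecidableEq V] (G : SimpleGraph V) (S : Set V) : Prop :=
  ∃ D : V → V → Bool, (∀ u w, D u w = true → G.Adj u w ∧ u ∈ S ∧ w ∈ S) ∧
    (∀ u w, u ∈ S → w ∈ S → G.Adj u w → D u w ≠ D w u) ∧ (∀ x ∈ S, ∃ y : V, D x y = true) ∧
      Nat.card {F : Finset (V × V) // IsEulerianSubgraph D F ∧ Even F.card} ≠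
        Nat.card {F : Finset (V × V) // IsEulerianSubgraph D F ∧ Odd F.card}

open Classical in
theorem PP_step {V : Type*} [Fintype V] [DecidableEq V] (G : SimpleGraph V) (S : Set V)
    (h : PP G S) (x s : V) (hx : x ∉ S) (hs : s ∈ S) (hxs : G.Adj x s) : PP G (insert x S) := by
  obtain ⟨D, h1, h2, h3, h4⟩ := h
  refine ⟨fun u w => D u w || decide (u = x ∧ w ∈ S ∧ G.Adj u w), ?_, ?_, ?_, ?_⟩
  · intro u w h
    simp only [Bool.or_eq_true, decide_eq_true_eq] at h
    rcases h with h | ⟨rfl, h, h'⟩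
    · have := h1 u w h
      simp [this]
    · simp [h, h']
  · intro u w hu hw ha
    have hne := ha.ne
    have hDx : ∀ z, D x z = false := fun z => by
      by_contra hc
      exact hx (h1 x z (by simpa using hc)).2.1
    have hDx' : ∀ z, D z x = false := fun z => by
      by_contra hc
      exact hx (h1 z x (by simpa using hc)).2.2
    rcases hu with rfl | hu <;> rcases hw with rfl | hw
    · exact absurd rfl hne
    · simp [hDx, hDx', hw, ha, hx]
    · simp [hDx, hDx', hu, ha.symm, hx]
    · have e1 : u ≠ x := fun h => hx (h ▸ hu)
      have e2 : w ≠ x := fun h => hx (h ▸ hw)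
      simpa [e1, e2] using h2 u w hu hw ha
  · intro z hz
    rcases hz with rfl | hz
    · exact ⟨s, by simp [hs, hxs]⟩
    · obtain ⟨y, hy⟩ := h3 z hz
      exact ⟨y, by simp [hy]⟩
  · have key : ∀ F, IsEulerianSubgraph
        (fun u w => D u w || decide (u = x ∧ w ∈ S ∧ G.Adj u w)) F ↔ IsEulerianSubgraph D F := by
      intro F
      constructor
      · rintro ⟨a, b⟩
        refine ⟨?_, b⟩
        have hin : F.filter (fun p => p.2 = x) = ∅ := by
          rw [Finset.filter_eq_empty_iff]
          intro p hp hpx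
          have := a p hp
          simp only [Bool.or_eq_true, decide_eq_true_eq] at this
          rcases this with h | ⟨_, h, _⟩
          · exact hx (hpx ▸ (h1 _ _ h).2.2)
          · exact hx (hpx ▸ h)
        have hout : F.filter (fun p => p.1 = x) = ∅ := by
          rw [← Finset.card_eq_zero, ← b x, hin, Finset.card_empty]
        rw [Finset.filter_eq_empty_iff] at hout
        intro p hp
        have := a p hp
        simp only [Bool.or_eq_true, decide_eq_true_eq] at this
        rcases this with h | ⟨h, _⟩
        · exact h
        · exact absurd h (hout hp)
      · rintro ⟨a, b⟩
        exact ⟨fun p hp => by simp [a p hp], b⟩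
    simp only [key]
    exact h4

theorem cross_edge {V : Type*} (G : SimpleGraph V) (B S : Set V) (h : (G.induce B).Connected)
    (a b : V) (ha : a ∈ B) (hb : b ∈ B) (haS : a ∈ S) (hbS : b ∉ S) :
    ∃ x y, x ∈ B ∧ y ∈ B ∧ x ∈ S ∧ y ∉ S ∧ G.Adj x y := by
  obtain ⟨w⟩ := h.preconnected ⟨a, ha⟩ ⟨b, hb⟩
  obtain ⟨d, _, h1, h2⟩ := w.exists_boundary_dart (Subtype.val ⁻¹' S) haS hbS
  exact ⟨d.fst, d.snd, d.fst.2, d.snd.2, h1, h2, d.adj⟩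

theorem PP_univ {V : Type*} [Fintype V] [DecidableEq V] (G : SimpleGraph V)
    (hconn : G.Connected) (S : Set V) (hne : S.Nonempty) (h : PP G S) : PP G Set.univ := by
  induction hn : (Sᶜ).ncard using Nat.strong_induction_on generalizing S with
  | _ n ih =>
    by_cases hS : S = Set.univ
    · exact hS ▸ h
    · obtain ⟨a, ha⟩ := hne
      obtain ⟨b, hb⟩ := (Set.ne_univ_iff_exists_notMem S).1 hS
      obtain ⟨w⟩ := hconn.preconnected a b
      obtain ⟨d, _, h1, h2⟩ := w.exists_boundary_dart S ha hb
      refine ih _ ?_ (insert d.snd S) (Set.insert_nonempty _ _)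
        (PP_step G S h d.snd d.fst h2 h1 d.adj.symm) rfl
      rw [← hn]
      apply Set.ncard_lt_ncard _ (Set.toFinite _)
      rw [Set.ssubset_iff_exists]
      exact ⟨Set.compl_subset_compl.2 (Set.subset_insert _ _), d.snd, h2, by simp⟩

/-- path-like data for a cycle -/
def CycF {V : Type*} (G : SimpleGraph V) (n : ℕ) (c : ℕ → V) : Prop :=
  3 ≤ n ∧ (∀ i j, i < n → j < n → c i = c j → i = j) ∧
    (∀ i, i + 1 < n → G.Adj (c i) (c (i + 1))) ∧ G.Adj (c (n - 1)) (c 0)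

open Classical in
theorem PP_cycle {V : Type*} [Fintype V] [DecidableEq V] (G : SimpleGraph V) (n : ℕ) (c : ℕ → V)
    (hc : CycF G n c) (hn : Even n) (a : ℕ)
    (hch : ∀ i j, i < j → j < n → G.Adj (c i) (c j) → j = i + 1 ∨ (i = 0 ∧ j = n - 1) ∨
      (i = 0 ∧ j = a)) : PP G {v | ∃ i < n, v = c i} := by
  obtain ⟨h3, inj, hadj, hcl⟩ := hc
  set R : ℕ → ℕ → Prop := fun i j => j = i + 1 ∨ (i = n - 1 ∧ j = 0) ∨
    (i = 0 ∧ j = a ∧ 2 ≤ a ∧ a + 2 ≤ n) with hR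
  set D : V → V → Bool := fun u w =>
    decide (∃ i j, i < n ∧ j < n ∧ u = c i ∧ w = c j ∧ G.Adj u w ∧ R i j) with hD
  have D1 : ∀ u w, D u w = true ↔
      ∃ i j, i < n ∧ j < n ∧ u = c i ∧ w = c j ∧ G.Adj u w ∧ R i j := by
    intro u w; simp [hD]
  have D2 : ∀ i j, i < n → j < n → (D (c i) (c j) = true ↔ (G.Adj (c i) (c j) ∧ R i j)) := by
    intro i j hi hj
    rw [D1]
    constructor
    · rintro ⟨i', j', hi', hj', e1, e2, h, h'⟩
      rw [inj i i' hi hi' e1, inj j j' hj hj' e2] at *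
      exact ⟨h, h'⟩
    · rintro ⟨h, h'⟩
      exact ⟨i, j, hi, hj, rfl, rfl, h, h'⟩
  have e0 : ∀ i, i < n → D (c i) (c ((i + 1) % n)) = true := by
    intro i hi
    by_cases h : i + 1 < n
    · rw [Nat.mod_eq_of_lt h, D2 i _ hi h]
      exact ⟨hadj i h, Or.inl rfl⟩
    · have : i + 1 = n := by omega
      rw [this, Nat.mod_self, D2 i 0 hi (by omega)]
      have : i = n - 1 := by omega
      subst this
      exact ⟨hcl, Or.inr (Or.inl ⟨rfl, rfl⟩)⟩
  have uniq : ∀ F F', IsEulerianSubgraph D F → IsEulerianSubgraph D F' →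
      F.filter (fun p => p.1 = c 0) = F'.filter (fun p => p.1 = c 0) → F = F' := by
    intro F F' hF hF' h0
    have main : ∀ i, i < n → F.filter (fun p => p.1 = c i) = F'.filter (fun p => p.1 = c i) := by
      intro i
      induction i with
      | zero => intro _; exact h0
      | succ i ih =>
        intro hi
        have ih := ih (by omega)
        have hin : F.filter (fun p => p.2 = c (i+1)) = F'.filter (fun p => p.2 = c (i+1)) := by
          have gen : ∀ p : V × V, D p.1 p.2 = true → p.2 = c (i+1) → (p ∈ F ↔ p ∈ F') := by
            rintro ⟨u, w⟩ hp rfl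
            obtain ⟨s, t, hs, ht, rfl, e2, -, hr⟩ := (D1 _ _).1 hp
            have := inj _ _ hi ht e2
            subst this
            have hs' : s = i ∨ s = 0 := by
              rcases hr with h | h | h <;> omega
            rcases hs' with rfl | rfl
            · have := Finset.ext_iff.1 ih (c s, c (s+1))
              simpa using this
            · have := Finset.ext_iff.1 h0 (c 0, c (i+1))
              simpa using this
          ext p
          simp only [Finset.mem_filter]
          constructor
          · rintro ⟨h, h'⟩
            exact ⟨(gen p (hF.1 p h) h').1 h, h'⟩
          · rintro ⟨h, h'⟩
            exact ⟨(gen p (hF'.1 p h) h').2 h, h'⟩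
        have hcard : (F.filter (fun p => p.1 = c (i+1))).card =
            (F'.filter (fun p => p.1 = c (i+1))).card := by
          rw [← hF.2, ← hF'.2, hin]
        have sub : ∀ F, IsEulerianSubgraph D F → F.filter (fun p => p.1 = c (i+1)) ⊆
            {(c (i+1), c ((i+1+1) % n))} := by
          intro F hF p hp
          rw [Finset.mem_filter] at hp
          obtain ⟨hp, hp1⟩ := hp
          obtain ⟨u, w⟩ := p
          obtain ⟨s, t, hs, ht, e1, e2, -, hr⟩ := (D1 _ _).1 (hF.1 _ hp)
          simp only at e1 e2 hp1
          subst hp1 e2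
          have := inj _ _ hi hs e1
          subst this
          have : t = (i + 1 + 1) % n := by
            rcases hr with h | h | h
            · subst h; rw [Nat.mod_eq_of_lt ht]
            · have : i + 1 + 1 = n := by omega
              rw [this, Nat.mod_self, h.2]
            · omega
          rw [Finset.mem_singleton, this]
        rcases Finset.subset_singleton_iff.1 (sub F hF) with h | h <;>
        rcases Finset.subset_singleton_iff.1 (sub F' hF') with h' | h' <;>
        rw [h, h'] <;> rw [h, h'] at hcard <;> simp at hcard
    ext p
    have gen : ∀ p : V × V, D p.1 p.2 = true → (p ∈ F ↔ p ∈ F') := by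
      intro p hp
      obtain ⟨s, t, hs, ht, e1, e2, -, hr⟩ := (D1 _ _).1 hp
      have := Finset.ext_iff.1 (main s hs) p
      simpa [e1] using this
    exact ⟨fun h => (gen p (hF.1 p h)).1 h, fun h => (gen p (hF'.1 p h)).2 h⟩
  set C : Finset (V × V) := (Finset.range n).image (fun i => (c i, c ((i + 1) % n))) with hC
  have hinjC : Set.InjOn (fun i => (c i, c ((i + 1) % n))) (Finset.range n) := by
    intro i hi j hj h
    simp only [Finset.coe_range, Set.mem_Iio] at hi hj
    exact inj i j hi hj (Prod.ext_iff.1 h).1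
  have hCcard : C.card = n := by
    rw [hC, Finset.card_image_of_injOn hinjC, Finset.card_range]
  have hCE : IsEulerianSubgraph D C := by
    constructor
    · intro p hp
      obtain ⟨i, hi, rfl⟩ := Finset.mem_image.1 hp
      exact e0 i (Finset.mem_range.1 hi)
    · intro v
      rw [hC, Finset.filter_image, Finset.filter_image,
        Finset.card_image_of_injOn (hinjC.mono (Finset.coe_subset.2 (Finset.filter_subset _ _))),
        Finset.card_image_of_injOn (hinjC.mono (Finset.coe_subset.2 (Finset.filter_subset _ _)))]
      apply Finset.card_bij (fun i _ => (i + 1) % n)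
      · intro i hi
        simp only [Finset.mem_filter, Finset.mem_range] at hi ⊢
        exact ⟨Nat.mod_lt _ (by omega), hi.2⟩
      · intro i hi j hj h
        simp only [Finset.mem_filter, Finset.mem_range] at hi hj
        have h1 := hi.1
        have h2 := hj.1
        have h' : i + 1 ≡ j + 1 [MOD n] := h
        have := Nat.ModEq.add_right_cancel' 1 h'
        exact Nat.ModEq.eq_of_lt_of_lt this h1 h2
      · intro j hj
        simp only [Finset.mem_filter, Finset.mem_range] at hj
        by_cases hj0 : j = 0
        · have e : (n - 1 + 1) % n = 0 := by
            rw [Nat.sub_add_cancel (by omega), Nat.mod_self]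
          refine ⟨n - 1, ?_, ?_⟩
          · simp only [Finset.mem_filter, Finset.mem_range, e]
            exact ⟨by omega, hj0 ▸ hj.2⟩
          · rw [e, hj0]
        · have e : (j - 1 + 1) % n = j := by
            rw [Nat.sub_add_cancel (by omega), Nat.mod_eq_of_lt hj.1]
          refine ⟨j - 1, ?_, e⟩
          simp only [Finset.mem_filter, Finset.mem_range, e]
          exact ⟨by omega, hj.2⟩
  have hEE : IsEulerianSubgraph D ∅ := ⟨by simp, by simp⟩
  have tri : ∀ F, IsEulerianSubgraph D F → Odd F.card →
      F.filter (fun p => p.1 = c 0) = {(c 0, c a)} := by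
    intro F hF hodd
    have hin : F.filter (fun p => p.2 = c 0) ⊆ {(c (n-1), c 0)} := by
      intro p hp
      rw [Finset.mem_filter] at hp
      obtain ⟨hp, hp1⟩ := hp
      obtain ⟨u, w⟩ := p
      obtain ⟨s, t, hs, ht, e1, e2, -, hr⟩ := (D1 _ _).1 (hF.1 _ hp)
      simp only at e1 e2 hp1
      subst hp1 e1
      have := inj _ _ (by omega) ht e2
      have : s = n - 1 := by
        rcases hr with h | h | h <;> omega
      rw [this]; simp
    have hcard : (F.filter (fun p => p.1 = c 0)).card ≤ 1 := by
      rw [← hF.2]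
      simpa using Finset.card_le_card hin
    have hsub : ∀ p ∈ F.filter (fun p => p.1 = c 0), p = (c 0, c 1) ∨ p = (c 0, c a) := by
      intro p hp
      rw [Finset.mem_filter] at hp
      obtain ⟨hp, hp1⟩ := hp
      obtain ⟨u, w⟩ := p
      obtain ⟨s, t, hs, ht, e1, e2, -, hr⟩ := (D1 _ _).1 (hF.1 _ hp)
      simp only at e1 e2 hp1
      subst hp1 e2
      have := inj _ _ (by omega) hs e1
      have : t = 1 ∨ t = a := by
        rcases hr with h | h | h <;> omega
      rcases this with rfl | rfl <;> simp
    rcases (F.filter (fun p => p.1 = c 0)).eq_empty_or_nonempty with h | ⟨p, hp⟩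
    · have := uniq F ∅ hF hEE (by rw [h]; simp)
      subst this
      simp at hodd
    · have hs : F.filter (fun p => p.1 = c 0) = {p} :=
        Finset.eq_singleton_iff_unique_mem.2 ⟨hp, fun q hq => Finset.card_le_one.1 hcard q hq p hp⟩
      rcases hsub p hp with rfl | rfl
      · have : C.filter (fun p => p.1 = c 0) = {(c 0, c 1)} := by
          ext q
          simp only [hC, Finset.mem_filter, Finset.mem_image, Finset.mem_range,
            Finset.mem_singleton]
          constructor
          · rintro ⟨⟨i, hi, rfl⟩, h⟩
            have := inj _ _ hi (by omega) h
            subst this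
            rw [Nat.mod_eq_of_lt (by omega)]
          · rintro rfl
            refine ⟨⟨0, by omega, ?_⟩, rfl⟩
            rw [Nat.mod_eq_of_lt (by omega)]
        have := uniq F C hF hCE (by rw [hs, this])
        subst this
        rw [hCcard] at hodd
        exact absurd hn (Nat.not_even_iff_odd.2 hodd)
      · exact hs
  refine ⟨D, ?_, ?_, ?_, ?_⟩
  · intro u w h
    obtain ⟨i, j, hi, hj, e1, e2, h, -⟩ := (D1 _ _).1 h
    exact ⟨h, ⟨i, hi, e1⟩, ⟨j, hj, e2⟩⟩
  · have half : ∀ i j, i < j → j < n → G.Adj (c i) (c j) → D (c i) (c j) ≠ D (c j) (c i) := by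
      intro i j hij hj h heq
      have h1 := D2 i j (by omega) hj
      have h2 := D2 j i hj (by omega)
      rw [heq] at h1
      have h5 := h1.symm.trans h2
      simp only [h, h.symm, true_and, hR] at h5
      have := hch i j hij hj h
      omega
    rintro u w ⟨i, hi, rfl⟩ ⟨j, hj, rfl⟩ h
    rcases lt_trichotomy i j with h' | rfl | h'
    · exact half i j h' hj h
    · exact absurd rfl h.ne
    · exact (half j i h' hi h.symm).symm
  · rintro x ⟨i, hi, rfl⟩
    exact ⟨_, e0 i hi⟩
  · apply ne_of_gt
    refine lt_of_le_of_lt (b := 1) ?_ ?_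
    · rw [Finite.card_le_one_iff_subsingleton]
      constructor
      rintro ⟨F, hF, ho⟩ ⟨F', hF', ho'⟩
      have := uniq F F' hF hF' (by rw [tri F hF ho, tri F' hF' ho'])
      simp [this]
    · rw [Finite.one_lt_card_iff_nontrivial]
      refine ⟨⟨∅, hEE, by simp⟩, ⟨C, hCE, by rw [hCcard]; exact hn⟩, ?_⟩
      intro h
      have := congrArg (fun x => x.1.card) h
      simp only [Finset.card_empty, hCcard] at this
      omega

theorem PP_cycle_ex {V : Type*} [Fintype V] [DecidableEq V] (G : SimpleGraph V) (n : ℕ)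
    (c : ℕ → V) (hc : CycF G n c) (hn : Even n) (a : ℕ)
    (hch : ∀ i j, i < j → j < n → G.Adj (c i) (c j) → j = i + 1 ∨ (i = 0 ∧ j = n - 1) ∨
      (i = 0 ∧ j = a)) : ∃ S : Set V, S.Nonempty ∧ PP G S :=
  ⟨{v | ∃ i < n, v = c i}, ⟨c 0, 0, lt_of_lt_of_le (by omega) hc.1, rfl⟩,
    PP_cycle G n c hc hn a hch⟩

/-- An ear outside `K`. -/
def EarF {V : Type*} (G : SimpleGraph V) (B K : Set V) (k : ℕ) (p : ℕ → V) (u v : V) : Prop :=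
  1 ≤ k ∧ (∀ i < k, p i ∈ B ∧ p i ∉ K) ∧ (∀ i, i + 1 < k → G.Adj (p i) (p (i + 1))) ∧
    G.Adj (p 0) u ∧ G.Adj (p (k - 1)) v ∧ u ∈ K ∧ v ∈ K ∧ u ≠ v

theorem exists_ear {V : Type*} (G : SimpleGraph V) (B K : Set V) (hB : (G.induce B).Connected)
    (hcut : NoCutVertex G B) (hKB : K ⊆ B) (u0 v0 b : V) (hu0 : u0 ∈ K) (hv0 : v0 ∈ K)
    (huv : u0 ≠ v0) (hb : b ∈ B) (hbK : b ∉ K) : ∃ k p u v, EarF G B K k p u v := by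
  obtain ⟨u, y, huB, hyB, huK, hyK, huy⟩ := cross_edge G B K hB u0 b (hKB hu0) hb hu0 hbK
  have hw : ∃ w ∈ K, w ≠ u := by
    by_cases h : u0 = u
    · exact ⟨v0, hv0, fun h' => huv (h.trans h'.symm)⟩
    · exact ⟨u0, hu0, h⟩
  obtain ⟨w, hwK, hwu⟩ := hw
  rcases hcut u huB with h | h
  · have := hKB hwK
    rw [h] at this
    exact absurd this hwu
  set R : Set V := {z | ∃ (k : ℕ) (p : ℕ → V), 1 ≤ k ∧ (∀ i < k, p i ∈ B ∧ p i ∉ K) ∧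
    (∀ i, i + 1 < k → G.Adj (p i) (p (i + 1))) ∧ p 0 = y ∧ p (k - 1) = z} with hR
  have hyR : y ∈ R := ⟨1, fun _ => y, le_rfl, fun _ _ => ⟨hyB, hyK⟩, by intro i h; omega, rfl, rfl⟩
  have hwR : w ∉ R := by
    rintro ⟨k, p, h1, h2, -, -, rfl⟩
    exact (h2 (k-1) (by omega)).2 hwK
  obtain ⟨z, z', hz, hz', hzR, hzR', hzz⟩ := cross_edge G (B \ {u}) R h y w
    ⟨hyB, fun h => hyK (h ▸ huK)⟩ ⟨hKB hwK, hwu⟩ hyR hwR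
  obtain ⟨k, p, h1, h2, h3, h4, h5⟩ := hzR
  by_cases hK : z' ∈ K
  · exact ⟨k, p, u, z', h1, h2, h3, h4 ▸ huy.symm, h5 ▸ hzz, huK, hK, fun h => hz'.2 h.symm⟩
  · exfalso
    apply hzR'
    refine ⟨k + 1, fun i => if i < k then p i else z', by omega, ?_, ?_, ?_, ?_⟩
    · intro i hi
      dsimp only
      split_ifs with h
      · exact h2 i h
      · exact ⟨hz'.1, hK⟩
    · intro i hi
      dsimp only
      rw [if_pos (by omega)]
      split_ifs with h
      · exact h3 i h
      · have : i = k - 1 := by omega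
        rw [this, h5]; exact hzz
    · simp only [show 0 < k by omega, if_true]; exact h4
    · simp

theorem exists_min_ear {V : Type*} (G : SimpleGraph V) (B K : Set V)
    (h : ∃ k p u v, EarF G B K k p u v) : ∃ k p u v, EarF G B K k p u v ∧
      (∀ i j, i < k → j < k → p i = p j → i = j) ∧
      (∀ i j, i < j → j < k → G.Adj (p i) (p j) → j = i + 1) ∧
      (∀ i < k, ∀ w ∈ K, G.Adj (p i) w → (w ≠ u → i = k - 1) ∧ (w ≠ v → i = 0)) := by
  classical
  obtain ⟨p, u, v, hE⟩ := Nat.find_spec h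
  have hmin : ∀ k' p' u' v', EarF G B K k' p' u' v' → Nat.find h ≤ k' :=
    fun k' p' u' v' h' => Nat.find_min' h ⟨p', u', v', h'⟩
  set k := Nat.find h with hk
  clear_value k
  obtain ⟨h1, h2, h3, h4, h5, h6, h7, h8⟩ := hE
  have trunc : ∀ i < k, ∀ w ∈ K, G.Adj (p i) w → w ≠ u → i = k - 1 := by
    intro i hi w hw ha hne
    have := hmin (i + 1) p u w ⟨by omega, fun j hj => h2 j (by omega),
      fun j hj => h3 j (by omega), h4, by simpa using ha, h6, hw, hne.symm⟩
    omega
  have trunc' : ∀ i < k, ∀ w ∈ K, G.Adj (p i) w → w ≠ v → i = 0 := by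
    intro i hi w hw ha hne
    have := hmin (k - i) (fun t => p (i + t)) w v ⟨by omega, fun j hj => h2 _ (by omega),
      fun j hj => h3 _ (by omega), ha, by
        have : i + (k - i - 1) = k - 1 := by omega
        simp only [this]; exact h5, hw, h7, hne⟩
    omega
  have chord : ∀ i j, i < j → j < k → G.Adj (p i) (p j) → j = i + 1 := by
    intro i j hij hj ha
    have := hmin (k - (j - i - 1)) (fun t => if t ≤ i then p t else p (t + (j - i - 1))) u v
      ⟨by omega, ?_, ?_, ?_, ?_, h6, h7, h8⟩
    · omega
    · intro t ht
      dsimp only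
      split_ifs
      · exact h2 _ (by omega)
      · exact h2 _ (by omega)
    · intro t ht
      dsimp only
      split_ifs with a b b
      · exact h3 _ (by omega)
      · have e1 : t = i := by omega
        have e2 : t + 1 + (j - i - 1) = j := by omega
        rw [e2, e1]; exact ha
      · omega
      · have e2 : t + 1 + (j - i - 1) = t + (j - i - 1) + 1 := by omega
        rw [e2]; exact h3 _ (by omega)
    · simpa using h4
    · dsimp only
      rw [if_neg (by omega)]
      have : k - (j - i - 1) - 1 + (j - i - 1) = k - 1 := by omega
      rw [this]; exact h5
  have inj : ∀ i j, i < j → j < k → p i ≠ p j := by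
    intro i j hij hj he
    by_cases hjk : j + 1 < k
    · have := chord i (j + 1) (by omega) hjk (he ▸ h3 j hjk)
      omega
    · have : j = k - 1 := by omega
      have := trunc i (by omega) v h7 (by rw [he, this]; exact h5) h8.symm
      omega
  refine ⟨k, p, u, v, ⟨h1, h2, h3, h4, h5, h6, h7, h8⟩, ?_, chord, ?_⟩
  · intro i j hi hj he
    rcases lt_trichotomy i j with h | h | h
    · exact absurd he (inj i j h hj)
    · exact h
    · exact absurd he.symm (inj j i h hi)
  · intro i hi w hw ha
    exact ⟨trunc i hi w hw ha, trunc' i hi w hw ha⟩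

/-- path in `K` from `u` to `v` with `m` vertices, induced up to the edge between the ends -/
def PathF {V : Type*} (G : SimpleGraph V) (K : Set V) (m : ℕ) (q : ℕ → V) (u v : V) : Prop :=
  2 ≤ m ∧ (∀ i < m, q i ∈ K) ∧ (∀ i j, i < m → j < m → q i = q j → i = j) ∧
    (∀ i, i + 1 < m → G.Adj (q i) (q (i + 1))) ∧ q 0 = u ∧ q (m - 1) = v ∧
    (∀ i j, i < j → j < m → G.Adj (q i) (q j) → j = i + 1 ∨ (i = 0 ∧ j = m - 1))

theorem PP_of_K {V : Type*} [Fintype V] [DecidableEq V] (G : SimpleGraph V) (B K : Set V)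
    (hB : (G.induce B).Connected) (hcut : NoCutVertex G B) (hKB : K ⊆ B) (hne : K ≠ B)
    (u0 v0 : V) (hu0 : u0 ∈ K) (hv0 : v0 ∈ K) (huv : u0 ≠ v0)
    (hone : ∀ x ∈ B, x ∉ K → ∀ u ∈ K, ∀ v ∈ K, G.Adj x u → G.Adj x v → u = v)
    (hpath : ∀ u ∈ K, ∀ v ∈ K, u ≠ v → ∀ r : ℕ, ∃ m q, PathF G K m q u v ∧ Even (m + r)) :
    ∃ S : Set V, S.Nonempty ∧ PP G S := by
  obtain ⟨b, hb, hbK⟩ : ∃ b ∈ B, b ∉ K := by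
    by_contra hcon
    push Not at hcon
    exact hne (Set.Subset.antisymm hKB hcon)
  obtain ⟨k, p, u, v, ⟨h1, h2, h3, h4, h5, h6, h7, h8⟩, pinj, pch, patt⟩ :=
    exists_min_ear G B K (exists_ear G B K hB hcut hKB u0 v0 b hu0 hv0 huv hb hbK)
  have hk : 2 ≤ k := by
    by_contra hcon
    have : k = 1 := by omega
    subst this
    exact h8 (hone (p 0) (h2 0 (by omega)).1 (h2 0 (by omega)).2 u h6 v h7 h4 h5)
  obtain ⟨m, q, ⟨q1, q2, q3, q4, q5, q6, q7⟩, hev⟩ := hpath u h6 v h7 h8 k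
  set c : ℕ → V := fun t => if t < m then q t else p (k - 1 - (t - m)) with hc
  have c1 : ∀ t, t < m → c t = q t := fun t ht => by simp [hc, ht]
  have c2 : ∀ t, ¬ t < m → c t = p (k - 1 - (t - m)) := fun t ht => by simp [hc, ht]
  refine PP_cycle_ex G (m + k) c ⟨by omega, ?_, ?_, ?_⟩ hev (m - 1) ?_
  · intro i j hi hj he
    by_cases hi' : i < m <;> by_cases hj' : j < m
    · rw [c1 i hi', c1 j hj'] at he
      exact q3 i j hi' hj' he
    · rw [c1 i hi', c2 j hj'] at he
      exact absurd (he ▸ q2 i hi') (h2 _ (by omega)).2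
    · rw [c2 i hi', c1 j hj'] at he
      exact absurd (he.symm ▸ q2 j hj') (h2 _ (by omega)).2
    · rw [c2 i hi', c2 j hj'] at he
      have := pinj _ _ (by omega) (by omega) he
      omega
  · intro i hi
    by_cases hi' : i + 1 < m
    · rw [c1 i (by omega), c1 _ hi']
      exact q4 i hi'
    · by_cases hi2 : i < m
      · have e : i = m - 1 := by omega
        have e2 : k - 1 - (i + 1 - m) = k - 1 := by omega
        rw [c1 i hi2, c2 _ hi', e2, e, q6]
        exact h5.symm
      · rw [c2 i hi2, c2 _ hi']
        have e : k - 1 - (i - m) = k - 1 - (i + 1 - m) + 1 := by omega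
        rw [e]
        exact (h3 _ (by omega)).symm
  · rw [c2 _ (by omega), c1 0 (by omega), q5]
    have : k - 1 - (m + k - 1 - m) = 0 := by omega
    rw [this]; exact h4
  · intro i j hij hj ha
    by_cases hj' : j < m
    · rw [c1 i (by omega), c1 j hj'] at ha
      have := q7 i j hij hj' ha
      omega
    · by_cases hi' : i < m
      · rw [c1 i hi', c2 j hj'] at ha
        have hat := patt _ (by omega) _ (q2 i hi') ha.symm
        have hiu : q i = u → i = 0 := fun h => q3 _ _ hi' (by omega) (h.trans q5.symm)
        have hiv : q i = v → i = m - 1 := fun h => q3 _ _ hi' (by omega) (h.trans q6.symm)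
        by_cases hu : q i = u
        · have := hiu hu
          have := hat.2 (hu ▸ h8)
          omega
        · have := hat.1 hu
          by_cases hv : q i = v
          · have := hiv hv
            omega
          · have := hat.2 hv
            omega
      · rw [c2 i hi', c2 j hj'] at ha
        have := pch _ _ (by omega) (by omega) ha.symm
        omega

theorem CycF_rot {V : Type*} (G : SimpleGraph V) (n : ℕ) (c : ℕ → V) (hc : CycF G n c) (i : ℕ)
    (hi : i < n) : CycF G n (fun t => c ((t + i) % n)) := by
  obtain ⟨h3, inj, hadj, hcl⟩ := hc
  have step : ∀ t, t < n → G.Adj (c t) (c ((t + 1) % n)) := by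
    intro t ht
    by_cases h : t + 1 < n
    · rw [Nat.mod_eq_of_lt h]; exact hadj t h
    · have e : t + 1 = n := by omega
      have e2 : t = n - 1 := by omega
      rw [e, Nat.mod_self, e2]; exact hcl
  have hn : 0 < n := by omega
  refine ⟨h3, ?_, ?_, ?_⟩
  · intro s t hs ht h
    have h' : s + i ≡ t + i [MOD n] := inj _ _ (Nat.mod_lt _ hn) (Nat.mod_lt _ hn) h
    exact Nat.ModEq.eq_of_lt_of_lt (Nat.ModEq.add_right_cancel' i h') hs ht
  · intro t ht
    have := step ((t + i) % n) (Nat.mod_lt _ hn)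
    rw [Nat.mod_add_mod, show t + i + 1 = t + 1 + i by omega] at this
    exact this
  · have := step ((n - 1 + i) % n) (Nat.mod_lt _ hn)
    rw [Nat.mod_add_mod, show n - 1 + i + 1 = 0 + i + n by omega, Nat.add_mod_right] at this
    exact this

theorem CycF_rev {V : Type*} (G : SimpleGraph V) (n : ℕ) (c : ℕ → V) (hc : CycF G n c) :
    CycF G n (fun t => c ((n - t) % n)) := by
  obtain ⟨h3, inj, hadj, hcl⟩ := hc
  have e0 : (n - 0) % n = 0 := by simp
  have e1 : ∀ t, 0 < t → t < n → (n - t) % n = n - t := fun t h1 h2 => Nat.mod_eq_of_lt (by omega)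
  refine ⟨h3, ?_, ?_, ?_⟩
  · intro s t hs ht h
    have h' := inj _ _ (Nat.mod_lt _ (by omega)) (Nat.mod_lt _ (by omega)) h
    rcases Nat.eq_zero_or_pos s with rfl | hs0 <;> rcases Nat.eq_zero_or_pos t with rfl | ht0
    · rfl
    · rw [e0, e1 t ht0 ht] at h'; omega
    · rw [e0, e1 s hs0 hs] at h'; omega
    · rw [e1 t ht0 ht, e1 s hs0 hs] at h'; omega
  · intro t ht
    dsimp only
    rw [e1 (t+1) (by omega) ht]
    rcases Nat.eq_zero_or_pos t with rfl | h
    · rw [e0]; exact hcl.symm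
    · rw [e1 t h (by omega)]
      have : n - t = n - (t + 1) + 1 := by omega
      rw [this]
      exact (hadj _ (by omega)).symm
  · dsimp only
    rw [e0, e1 (n-1) (by omega) (by omega), show n - (n - 1) = 0 + 1 by omega]
    exact (hadj 0 (by omega)).symm

/-- pull two distinct cycle vertices to positions `0` and `j`, in both directions -/
theorem CycF_two {V : Type*} (G : SimpleGraph V) (n : ℕ) (c : ℕ → V) (hc : CycF G n c) (a b : ℕ)
    (ha : a < n) (hb : b < n) (hab : a ≠ b) : ∃ c1 c2 j, CycF G n c1 ∧ CycF G n c2 ∧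
      (∀ t, ∃ s < n, c1 t = c s) ∧ (∀ t, ∃ s < n, c2 t = c s) ∧ 0 < j ∧ j < n ∧
      c1 0 = c a ∧ c1 j = c b ∧ c2 0 = c a ∧ c2 (n - j) = c b := by
  have hn : 0 < n := by omega
  have hr := CycF_rot G n c hc a ha
  obtain ⟨j, hj0, hj, e⟩ : ∃ j, 0 < j ∧ j < n ∧ (j + a) % n = b := by
    rcases lt_or_gt_of_ne hab with h | h
    · exact ⟨b - a, by omega, by omega, by rw [Nat.sub_add_cancel h.le, Nat.mod_eq_of_lt hb]⟩
    · refine ⟨b + n - a, by omega, by omega, ?_⟩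
      rw [Nat.sub_add_cancel (by omega), Nat.add_mod_right, Nat.mod_eq_of_lt hb]
  refine ⟨_, _, j, hr, CycF_rev G n _ hr, ?_, ?_, hj0, hj, ?_, ?_, ?_, ?_⟩
  · intro t; exact ⟨_, Nat.mod_lt _ hn, rfl⟩
  · intro t; exact ⟨_, Nat.mod_lt _ hn, rfl⟩
  · simp [Nat.mod_eq_of_lt ha]
  · simp only [e]
  · simp [Nat.mod_eq_of_lt ha]
  · have : n - (n - j) = j := by omega
    simp only [this, Nat.mod_eq_of_lt hj, e]

theorem exists_cycle_in {V : Type*} (G : SimpleGraph V) (B : Set V)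
    (hB : (G.induce B).Connected) (hcut : NoCutVertex G B) (hcl : ¬ G.IsClique B) :
    ∃ n c, CycF G n c ∧ ∀ i < n, c i ∈ B := by
  obtain ⟨a, ha, b, hb, hab, hnadj⟩ : ∃ a ∈ B, ∃ b ∈ B, a ≠ b ∧ ¬ G.Adj a b := by
    by_contra hcon
    push Not at hcon
    exact hcl fun a ha b hb hab => hcon a ha b hb hab
  obtain ⟨u, v, hu, hv, -, -, huv⟩ := cross_edge G B {a} hB a b ha hb rfl (fun h => hab h.symm)
  obtain ⟨x, hx, hxK⟩ : ∃ x ∈ B, x ∉ ({u, v} : Set V) := by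
    by_contra hcon
    push Not at hcon
    have h1 := hcon a ha
    have h2 := hcon b hb
    simp only [Set.mem_insert_iff, Set.mem_singleton_iff] at h1 h2
    rcases h1 with rfl | rfl <;> rcases h2 with rfl | rfl
    · exact hab rfl
    · exact hnadj huv
    · exact hnadj huv.symm
    · exact hab rfl
  have hKB : ({u, v} : Set V) ⊆ B := by
    rintro z (rfl | rfl) <;> assumption
  obtain ⟨k, p, u', v', ⟨h1, h2, h3, h4, h5, h6, h7, h8⟩, pinj, -, -⟩ :=
    exists_min_ear G B {u, v} (exists_ear G B {u, v} hB hcut hKB u v x (by simp) (by simp)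
      huv.ne hx hxK)
  have huv' : G.Adj u' v' := by
    rcases h6 with rfl | rfl <;> rcases h7 with rfl | rfl
    · exact absurd rfl h8
    · exact huv
    · exact huv.symm
    · exact absurd rfl h8
  set c : ℕ → V := fun t => if t < k then p t else if t = k then v' else u' with hc
  have c1 : ∀ t, t < k → c t = p t := fun t ht => by simp [hc, ht]
  have c2 : c k = v' := by simp [hc]
  have c3 : c (k + 1) = u' := by simp [hc]
  have hp : ∀ i < k, p i ≠ u' ∧ p i ≠ v' := fun i hi =>
    ⟨fun h => (h2 i hi).2 (h ▸ h6), fun h => (h2 i hi).2 (h ▸ h7)⟩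
  have cs : ∀ t, t < k + 2 → t < k ∨ t = k ∨ t = k + 1 := by intro t ht; omega
  refine ⟨k + 2, c, ⟨by omega, ?_, ?_, ?_⟩, ?_⟩
  · intro i j hi hj he
    rcases cs i hi with h | rfl | rfl <;> rcases cs j hj with h' | rfl | rfl
    · rw [c1 i h, c1 j h'] at he; exact pinj i j h h' he
    · rw [c1 i h, c2] at he; exact absurd he (hp i h).2
    · rw [c1 i h, c3] at he; exact absurd he (hp i h).1
    · rw [c1 j h', c2] at he; exact absurd he.symm (hp j h').2
    · rfl
    · rw [c2, c3] at he; exact absurd he.symm h8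
    · rw [c1 j h', c3] at he; exact absurd he.symm (hp j h').1
    · rw [c2, c3] at he; exact absurd he h8
    · rfl
  · intro i hi
    by_cases h : i + 1 < k
    · rw [c1 i (by omega), c1 _ h]; exact h3 i h
    · by_cases h' : i + 1 = k
      · rw [c1 i (by omega), h', c2, show i = k - 1 by omega]; exact h5
      · have : i = k := by omega
        rw [this, c2, c3]; exact huv'.symm
  · rw [show k + 2 - 1 = k + 1 by omega, c3, c1 0 (by omega)]
    exact h4.symm
  · intro i hi
    rcases cs i hi with h | rfl | rfl
    · rw [c1 i h]; exact (h2 i h).1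
    · rw [c2]; exact hKB h7
    · rw [c3]; exact hKB h6

theorem odd_cycle_set {V : Type*} (G : SimpleGraph V) (n : ℕ) (c : ℕ → V) (hc : CycF G n c)
    (hodd : Odd n) (hch : ∀ i j, i < j → j < n → G.Adj (c i) (c j) → j = i + 1 ∨
      (i = 0 ∧ j = n - 1)) (B : Set V) (hB : B = {v | ∃ i < n, v = c i}) : IsOddCycleSet G B := by
  subst hB
  obtain ⟨h3, inj, hadj, hcl⟩ := hc
  refine ⟨n, hodd, h3, ⟨RelIso.symm ⟨Equiv.ofBijective
    (fun i : Fin n => (⟨c i, i, i.2, rfl⟩ : {v | ∃ i < n, v = c i})) ⟨?_, ?_⟩, ?_⟩⟩⟩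
  · intro i j h
    exact Fin.ext (inj _ _ i.2 j.2 (Subtype.ext_iff.1 h))
  · rintro ⟨v, i, hi, rfl⟩
    exact ⟨⟨i, hi⟩, rfl⟩
  · have half : ∀ i j : Fin n, i < j → (G.Adj (c i) (c j) ↔ (SimpleGraph.cycleGraph n).Adj i j) := by
      intro i j hij
      have hij' : (i : ℕ) < j := hij
      have hi := i.2
      have hj := j.2
      rw [SimpleGraph.cycleGraph_adj', Fin.sub_def, Fin.sub_def]
      simp only
      have e1 : (n - (i : ℕ) + j) % n = j - i := by
        rw [show n - (i : ℕ) + j = j - i + n by omega, Nat.add_mod_right, Nat.mod_eq_of_lt (by omega)]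
      have e2 : (n - (j : ℕ) + i) % n = n - (j - i) := by
        rw [show n - (j : ℕ) + i = n - (j - i) by omega, Nat.mod_eq_of_lt (by omega)]
      rw [e1, e2]
      constructor
      · intro h
        have := hch i j hij' hj h
        omega
      · intro h
        have : (j : ℕ) = i + 1 ∨ ((i : ℕ) = 0 ∧ (j : ℕ) = n - 1) := by omega
        rcases this with h | ⟨h, h'⟩
        · rw [h]; exact hadj _ (by omega)
        · rw [h, h']; exact hcl.symm
    intro i j
    change G.Adj (c i) (c j) ↔ _
    rcases lt_trichotomy i j with h | rfl | h
    · exact half i j h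
    · simp
    · rw [G.adj_comm, (SimpleGraph.cycleGraph n).adj_comm]; exact half j i h

theorem clique_case {V : Type*} [Fintype V] [DecidableEq V] (G : SimpleGraph V) (B : Set V)
    (hB : (G.induce B).Connected) (hcut : NoCutVertex G B) (hcl : ¬ G.IsClique B)
    (T : Set V) (hT : G.IsClique T) (hTB : T ⊆ B) (x y z : V) (hx : x ∈ T) (hy : y ∈ T)
    (hz : z ∈ T) (hxy : x ≠ y) (hxz : x ≠ z) (hyz : y ≠ z) :
    ∃ S : Set V, S.Nonempty ∧ PP G S := by
  by_contra hno
  obtain ⟨K, hTK, hK⟩ := Finite.exists_le_maximal (p := fun K : Set V => G.IsClique K ∧ K ⊆ B)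
    (a := T) ⟨hT, hTB⟩
  obtain ⟨⟨hKc, hKB⟩, hmax⟩ := hK
  have hTK' : T ⊆ K := hTK
  apply hno
  apply PP_of_K G B K hB hcut hKB (fun h => hcl (h ▸ hKc)) x y (hTK hx) (hTK hy) hxy
  · intro v hvB hvK u hu w hw hvu hvw
    by_contra huw
    apply hno
    have hnot : ¬ ∀ s ∈ K, G.Adj v s := by
      intro hall
      have : insert v K ≤ K := hmax ⟨hKc.insert (fun s hs _ => hall s hs),
        Set.insert_subset hvB hKB⟩ (Set.subset_insert _ _)
      exact hvK (this (Set.mem_insert _ _))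
    push Not at hnot
    obtain ⟨s, hs, hvs⟩ := hnot
    have hus : u ≠ s := fun h => hvs (h ▸ hvu)
    have hws : w ≠ s := fun h => hvs (h ▸ hvw)
    have a1 : G.Adj u s := hKc hu hs hus
    have a2 : G.Adj w s := hKc hw hs hws
    have hsv : s ≠ v := fun h => hvK (h ▸ hs)
    have huv := hvu.ne
    have hwv := hvw.ne
    set c : ℕ → V := fun t => if t = 0 then u else if t = 1 then s else if t = 2 then w else v
      with hc
    have c0 : c 0 = u := rfl
    have c1 : c 1 = s := rfl
    have c2 : c 2 = w := rfl
    have c3 : c 3 = v := rfl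
    refine PP_cycle_ex G 4 c ⟨by omega, ?_, ?_, ?_⟩ (by decide) 2 ?_
    · intro i j hi hj h
      interval_cases i <;> interval_cases j <;> simp only [c0, c1, c2, c3] at h <;> first
        | rfl
        | (subst h; contradiction)
        | (subst h; exact absurd rfl hsv)
        | (exact absurd h.symm (by assumption))
    · intro i hi
      have : i < 3 := by omega
      interval_cases i
      · exact a1
      · exact a2.symm
      · exact hvw.symm
    · exact hvu
    · intro i j hij hj h
      have hi : i < 3 := by omega
      interval_cases j <;> interval_cases i <;> first
        | omega
        | exact absurd h.symm hvs
  · intro u hu v hv huv r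
    obtain ⟨w, hw, hwu, hwv⟩ : ∃ w ∈ K, w ≠ u ∧ w ≠ v := by
      by_contra hcon
      push Not at hcon
      have h1 := hcon x (hTK hx)
      have h2 := hcon y (hTK hy)
      have h3 := hcon z (hTK hz)
      by_cases e1 : x = u
      · have f2 := h2 (fun h => hxy (e1.trans h.symm))
        have f3 := h3 (fun h => hxz (e1.trans h.symm))
        exact hyz (f2.trans f3.symm)
      · have f1 := h1 e1
        by_cases e2 : y = u
        · have f3 := h3 (fun h => hyz (e2.trans h.symm))
          exact hxz (f1.trans f3.symm)
        · exact hxy (f1.trans (h2 e2).symm)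
    rcases Nat.even_or_odd r with hr | hr
    · refine ⟨2, fun t => if t = 0 then u else v, ⟨le_rfl, ?_, ?_, ?_, rfl, rfl, ?_⟩,
        by simpa [Nat.even_add] using hr⟩
      · intro i _; dsimp only; split_ifs <;> assumption
      · intro i j hi hj h
        dsimp only at h
        split_ifs at h
        · omega
        · exact absurd h huv
        · exact absurd h.symm huv
        · omega
      · intro i hi
        have : i = 0 := by omega
        subst this
        exact hKc hu hv huv
      · intro i j hij hj _
        omega
    · refine ⟨3, fun t => if t = 0 then u else if t = 1 then w else v,
        ⟨by omega, ?_, ?_, ?_, rfl, rfl, ?_⟩, ?_⟩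
      · intro i _; dsimp only; split_ifs <;> assumption
      · intro i j hi hj h
        dsimp only at h
        split_ifs at h <;> first | omega | (exact absurd h (by assumption)) |
          (exact absurd h.symm (by assumption))
      · intro i hi
        have : i < 2 := by omega
        interval_cases i
        · exact hKc hu hw hwu.symm
        · exact hKc hw hv hwv
      · intro i j hij hj _
        omega
      · obtain ⟨y, hy⟩ := hr
        rw [Nat.even_iff]
        omega

theorem block_good {V : Type*} [Fintype V] [DecidableEq V] (G : SimpleGraph V) (B : Set V)
    (hB : (G.induce B).Connected) (hcut : NoCutVertex G B) (hcl : ¬ G.IsClique B)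
    (hodd : ¬ IsOddCycleSet G B) : ∃ S : Set V, S.Nonempty ∧ PP G S := by
  classical
  have hex := exists_cycle_in G B hB hcut hcl
  obtain ⟨c, hc, hcB⟩ := Nat.find_spec hex
  have hmin : ∀ n' c', CycF G n' c' → (∀ i < n', c' i ∈ B) → Nat.find hex ≤ n' :=
    fun n' c' h1 h2 => Nat.find_min' hex ⟨c', h1, h2⟩
  set n := Nat.find hex with hn
  clear_value n
  have chordless : ∀ c, CycF G n c → (∀ i < n, c i ∈ B) → ∀ i j, i < j → j < n →
      G.Adj (c i) (c j) → j = i + 1 ∨ (i = 0 ∧ j = n - 1) := by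
    intro c hc hcB i j hij hj ha
    by_contra hcon
    have := hmin (j - i + 1) (fun t => c (i + t)) ⟨by omega, ?_, ?_, ?_⟩ ?_
    · omega
    · intro s t hs ht h
      have := hc.2.1 _ _ (by omega) (by omega) h
      omega
    · intro t ht
      exact hc.2.2.1 _ (by omega)
    · dsimp only
      rw [show i + (j - i + 1 - 1) = j by omega]
      exact ha.symm
    · intro t ht
      exact hcB _ (by omega)
  have hn3 := hc.1
  rcases Nat.even_or_odd n with hev | ho
  · refine PP_cycle_ex G n c hc hev 0 ?_
    intro i j hij hj h
    have := chordless c hc hcB i j hij hj h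
    omega
  by_cases h3 : n = 3
  · subst h3
    have a01 : G.Adj (c 0) (c 1) := hc.2.2.1 0 (by omega)
    have a12 : G.Adj (c 1) (c 2) := hc.2.2.1 1 (by omega)
    have a20 : G.Adj (c 2) (c 0) := hc.2.2.2
    refine clique_case G B hB hcut hcl {c 0, c 1, c 2} ?_ ?_ (c 0) (c 1) (c 2) (by simp) (by simp)
      (by simp) a01.ne a20.ne' a12.ne
    · simp [SimpleGraph.isClique_iff, Set.pairwise_insert, a01, a12, a20, a01.symm, a12.symm,
        a20.symm]
    · rintro z (rfl | rfl | rfl)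
      · exact hcB 0 (by omega)
      · exact hcB 1 (by omega)
      · exact hcB 2 (by omega)
  have hn5 : 5 ≤ n := by
    obtain ⟨m, hm⟩ := ho
    omega
  have hKB : {v | ∃ i < n, v = c i} ⊆ B := by
    rintro v ⟨i, hi, rfl⟩; exact hcB i hi
  refine PP_of_K G B {v | ∃ i < n, v = c i} hB hcut hKB ?_ (c 0) (c 1) ⟨0, by omega, rfl⟩
    ⟨1, by omega, rfl⟩ (hc.2.2.1 0 (by omega)).ne ?_ ?_
  · intro h
    exact hodd (odd_cycle_set G n c hc ho (chordless c hc hcB) B h.symm)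
  · rintro x hxB hxK u ⟨i, hi, rfl⟩ v ⟨j, hj, rfl⟩ hu hv
    by_contra hne
    obtain ⟨c1, c2, t, hc1, hc2, hs1, hs2, ht0, ht, e1, e2, e3, e4⟩ :=
      CycF_two G n c hc i j hi hj (fun h => hne (by rw [h]))
    have gen : ∀ (c' : ℕ → V) (t : ℕ), CycF G n c' → (∀ t, ∃ s < n, c' t = c s) → 0 < t → t < n →
        G.Adj x (c' 0) → G.Adj x (c' t) → n ≤ t + 2 := by
      intro c' t hc' hs ht0 ht ha hb
      have hx : ∀ r, c' r ≠ x := by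
        intro r h
        obtain ⟨s, hs, e⟩ := hs r
        exact hxK ⟨s, hs, by rw [← e, h]⟩
      refine hmin (t + 2) (fun r => if r ≤ t then c' r else x) ⟨by omega, ?_, ?_, ?_⟩ ?_
      · intro a b h1 h2 h
        dsimp only at h
        split_ifs at h
        · exact hc'.2.1 _ _ (by omega) (by omega) h
        · exact absurd h (hx _)
        · exact absurd h.symm (hx _)
        · omega
      · intro a h1
        dsimp only
        rw [if_pos (by omega)]
        split_ifs with h
        · exact hc'.2.2.1 _ (by omega)
        · rw [show a = t by omega]; exact hb.symm
      · dsimp only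
        rw [if_neg (by omega), if_pos (by omega)]
        exact ha
      · intro a h1
        split_ifs
        · obtain ⟨s, hs, e⟩ := hs a
          rw [e]; exact hcB s hs
        · exact hxB
    have g1 := gen c1 t hc1 hs1 ht0 ht (e1 ▸ hu) (e2 ▸ hv)
    have g2 := gen c2 (n - t) hc2 hs2 (by omega) (by omega) (e3 ▸ hu) (e4 ▸ hv)
    omega
  · rintro u ⟨i, hi, rfl⟩ v ⟨j, hj, rfl⟩ hne r
    obtain ⟨c1, c2, t, hc1, hc2, hs1, hs2, ht0, ht, e1, e2, e3, e4⟩ :=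
      CycF_two G n c hc i j hi hj (fun h => hne (by rw [h]))
    have gen : ∀ (c' : ℕ → V) (t : ℕ), CycF G n c' → (∀ t, ∃ s < n, c' t = c s) → 0 < t → t < n →
        PathF G {v | ∃ i < n, v = c i} (t + 1) c' (c' 0) (c' t) := by
      intro c' t hc' hs ht0 ht
      refine ⟨by omega, fun a _ => hs a, fun a b h1 h2 => hc'.2.1 a b (by omega) (by omega),
        fun a h => hc'.2.2.1 a (by omega), rfl, rfl, ?_⟩
      intro a b hab hb h
      have := chordless c' hc' (fun q _ => by
        obtain ⟨s, hs, e⟩ := hs q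
        rw [e]; exact hcB s hs) a b hab (by omega) h
      omega
    by_cases hpar : Even (t + 1 + r)
    · exact ⟨t + 1, c1, e1 ▸ e2 ▸ gen c1 t hc1 hs1 ht0 ht, hpar⟩
    · refine ⟨n - t + 1, c2, e3 ▸ e4 ▸ gen c2 (n - t) hc2 hs2 (by omega) (by omega), ?_⟩
      rw [Nat.not_even_iff_odd] at hpar
      obtain ⟨x, hx⟩ := hpar
      obtain ⟨y, hy⟩ := ho
      rw [Nat.even_iff]
      omega

/-- A connected finite graph that is not a Gallai tree has an orientation in which every
vertex has an out-going edge and the numbers of even and odd Eulerian subgraphs differ. -/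
theorem exists_good_orientation {V : Type*} [Fintype V] [DecidableEq V] (G : SimpleGraph V)
    (hconn : G.Connected) (hG : ¬ IsGallaiTree G) :
    ∃ D : V → V → Bool, IsOrientation G D ∧ (∀ x : V, ∃ y : V, D x y = true) ∧
      Nat.card {F : Finset (V × V) // IsEulerianSubgraph D F ∧ Even F.card} ≠
        Nat.card {F : Finset (V × V) // IsEulerianSubgraph D F ∧ Odd F.card} := by
  unfold IsGallaiTree at hG
  push Not at hG
  obtain ⟨B, ⟨hB, hcut, -⟩, hcl, hodd⟩ := hG
  obtain ⟨S, hS, hP⟩ := block_good G B hB hcut hcl hodd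
  obtain ⟨D, h1, h2, h3, h4⟩ := PP_univ G hconn S hS hP
  exact ⟨D, ⟨fun u w h => (h1 u w h).1, fun u w h => h2 u w trivial trivial h⟩,
    fun x => h3 x trivial, h4⟩
end
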